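/- arXiv:1703.06608 — 5 statements merged into one kernel-verified Lean document; each statement's English description precedes it below -/
import Mathlib

section
/- For all real numbers a, b > 0 with a ≠ b, one has (2/3)·G + (1/3)·A < X < ((e−1)/e)·G + (1/e)·A, where e is Euler's number; that is, α·G + (1−α)·A < X < β·G + (1−β)·A holds with α = 2/3 and β = (e−1)/e. -/
open Real

/-- Arithmetic mean -/
noncomputable def Am (a b : ℝ) : ℝ := (a + b) / 2

/-- Geometric mean -/
noncomputable def Gm (a b : ℝ) : ℝ := Real.sqrt (a * b)

/-- Harmonic mean -/
noncomputable def Hm (a b : ℝ) : ℝ := 2 * a * b / (a + b)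

/-- Seiffert mean -/
noncomputable def Pm (a b : ℝ) : ℝ := (a - b) / (2 * Real.arcsin ((a - b) / (a + b)))

/-- Sándor's X mean -/
noncomputable def Xm (a b : ℝ) : ℝ := Am a b * Real.exp (Gm a b / Pm a b - 1)

/-- Logarithmic mean -/
noncomputable def Lm (a b : ℝ) : ℝ := (a - b) / (Real.log a - Real.log b)

/-- Identric mean -/
noncomputable def Im (a b : ℝ) : ℝ := (1 / Real.exp 1) * ((a ^ a) / (b ^ b)) ^ (1 / (a - b))

/-- Power mean -/
noncomputable def Mp (p a b : ℝ) : ℝ :=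
  if p = 0 then Real.sqrt (a * b) else ((a ^ p + b ^ p) / 2) ^ (1 / p)

/-- Power-type Heronian mean -/
noncomputable def Hp (p a b : ℝ) : ℝ :=
  if p = 0 then Real.sqrt (a * b) else ((a ^ p + (a * b) ^ (p / 2) + b ^ p) / 3) ^ (1 / p)

open Set

/-- The function whose monotonicity governs both comparisons of the mean `X` with convex
combinations of `G` and `A`. -/
noncomputable def logSubCot (k t : ℝ) : ℝ := log (1 + k * cos t) - cos t / sinc t

/-- The derivative of `logSubCot k`, multiplied by `sin t ^ 2`. -/
noncomputable def logSubCotSlope (k t : ℝ) : ℝ := t - sin t * (cos t + k) / (1 + k * cos t)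

lemma cos_nonneg_of_mem_Icc_zero_pi_div_two {t : ℝ} (ht : t ∈ Icc 0 (π / 2)) : 0 ≤ cos t :=
  cos_nonneg_of_mem_Icc ⟨by linarith [ht.1, pi_pos], ht.2⟩

lemma sinc_pos_of_mem_Icc_zero_pi_div_two {t : ℝ} (ht : t ∈ Icc 0 (π / 2)) : 0 < sinc t := by
  rcases ht.1.eq_or_lt with rfl | h
  · simp
  · rw [sinc_of_ne_zero h.ne']
    exact div_pos (sin_pos_of_pos_of_lt_pi h (by linarith [ht.2, pi_pos])) h

lemma one_add_mul_cos_pos {k t : ℝ} (hk : 0 < k) (ht : t ∈ Icc 0 (π / 2)) :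
    0 < 1 + k * cos t := by
  have := cos_nonneg_of_mem_Icc_zero_pi_div_two ht
  positivity

lemma continuousOn_logSubCot {k : ℝ} (hk : 0 < k) :
    ContinuousOn (logSubCot k) (Icc 0 (π / 2)) := by
  refine ContinuousOn.sub (ContinuousOn.log (by fun_prop) fun t ht => ?_)
    (continuous_cos.continuousOn.div continuous_sinc.continuousOn fun t ht => ?_)
  · exact (one_add_mul_cos_pos hk ht).ne'
  · exact (sinc_pos_of_mem_Icc_zero_pi_div_two ht).ne'

lemma hasDerivAt_logSubCot {k t : ℝ} (hk : 0 < k) (ht : t ∈ Ioo 0 (π / 2)) :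
    HasDerivAt (logSubCot k) (logSubCotSlope k t / sin t ^ 2) t := by
  have hq := one_add_mul_cos_pos hk (Ioo_subset_Icc_self ht)
  have hs : 0 < sin t := sin_pos_of_pos_of_lt_pi ht.1 (by linarith [ht.2, pi_pos])
  have h1 := (((hasDerivAt_cos t).const_mul k).const_add 1).log hq.ne'
  have h2 := ((hasDerivAt_id t).mul (hasDerivAt_cos t)).div (hasDerivAt_sin t) hs.ne'
  have h := h1.sub h2
  refine (h.congr_of_eventuallyEq ?_).congr_deriv ?_
  · filter_upwards [lt_mem_nhds ht.1] with x hx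
    simp [logSubCot, sinc_of_ne_zero hx.ne', mul_comm x]
    rw [div_div_eq_mul_div]
  · simp only [logSubCotSlope, id, Pi.mul_apply]
    field_simp
    linear_combination (-(k * sin t) + t * (1 + k * cos t)) * sin_sq_add_cos_sq t

lemma hasDerivAt_logSubCotSlope {k t : ℝ} (hk : 0 < k) (ht : t ∈ Icc 0 (π / 2)) :
    HasDerivAt (logSubCotSlope k)
      (sin t ^ 2 * (k * cos t + 2 - k ^ 2) / (1 + k * cos t) ^ 2) t := by
  have hq := one_add_mul_cos_pos hk ht
  have h := (hasDerivAt_id t).sub (((hasDerivAt_sin t).mul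
    ((hasDerivAt_cos t).add_const k)).div (((hasDerivAt_cos t).const_mul k).const_add 1) hq.ne')
  refine h.congr_deriv ?_
  simp only [Pi.mul_apply]
  rw [eq_div_iff (by positivity), sub_mul, div_mul_cancel₀ _ (by positivity)]
  linear_combination (-(k * cos t) - 1) * sin_sq_add_cos_sq t

lemma continuousOn_logSubCotSlope {k : ℝ} (hk : 0 < k) :
    ContinuousOn (logSubCotSlope k) (Icc 0 (π / 2)) := fun _ ht =>
  (hasDerivAt_logSubCotSlope hk ht).continuousAt.continuousWithinAt

lemma logSubCot_lt_of_slope_pos {k x y : ℝ} (hk : 0 < k) (hx : 0 ≤ x) (hxy : x < y)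
    (hy : y ≤ π / 2) (h : ∀ z ∈ Ioo x y, 0 < logSubCotSlope k z) :
    logSubCot k x < logSubCot k y := by
  refine strictMonoOn_of_deriv_pos (convex_Icc x y)
    ((continuousOn_logSubCot hk).mono (Icc_subset_Icc hx hy)) (fun z hz => ?_)
    (left_mem_Icc.2 hxy.le) (right_mem_Icc.2 hxy.le) hxy
  rw [interior_Icc] at hz
  have hz' := Ioo_subset_Ioo hx hy hz
  rw [(hasDerivAt_logSubCot hk hz').deriv]
  have hs : 0 < sin z := sin_pos_of_pos_of_lt_pi hz'.1 (by linarith [hz'.2, pi_pos])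
  have := h z hz
  positivity

lemma logSubCot_lt_of_slope_neg {k x y : ℝ} (hk : 0 < k) (hx : 0 ≤ x) (hxy : x < y)
    (hy : y ≤ π / 2) (h : ∀ z ∈ Ioo x y, logSubCotSlope k z < 0) :
    logSubCot k y < logSubCot k x := by
  refine strictAntiOn_of_deriv_neg (convex_Icc x y)
    ((continuousOn_logSubCot hk).mono (Icc_subset_Icc hx hy)) (fun z hz => ?_)
    (left_mem_Icc.2 hxy.le) (right_mem_Icc.2 hxy.le) hxy
  rw [interior_Icc] at hz
  have hz' := Ioo_subset_Ioo hx hy hz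
  rw [(hasDerivAt_logSubCot hk hz').deriv]
  have hs : 0 < sin z := sin_pos_of_pos_of_lt_pi hz'.1 (by linarith [hz'.2, pi_pos])
  exact div_neg_of_neg_of_pos (h z hz) (by positivity)

/-- The slope increases as long as `k * cos t + 2 - k ^ 2` stays nonnegative. -/
lemma logSubCotSlope_lt_of_nonneg {k x y : ℝ} (hk : 0 < k) (hx : 0 ≤ x) (hxy : x < y)
    (hy : y ≤ π / 2) (h : 0 ≤ k * cos y + 2 - k ^ 2) :
    logSubCotSlope k x < logSubCotSlope k y := by
  refine strictMonoOn_of_deriv_pos (convex_Icc x y)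
    ((continuousOn_logSubCotSlope hk).mono (Icc_subset_Icc hx hy)) (fun z hz => ?_)
    (left_mem_Icc.2 hxy.le) (right_mem_Icc.2 hxy.le) hxy
  rw [interior_Icc] at hz
  have hz' := Ioo_subset_Ioo hx hy hz
  rw [(hasDerivAt_logSubCotSlope hk (Ioo_subset_Icc_self hz')).deriv]
  have hs : 0 < sin z := sin_pos_of_pos_of_lt_pi hz'.1 (by linarith [hz'.2, pi_pos])
  have hq := one_add_mul_cos_pos hk (Ioo_subset_Icc_self hz')
  have hc : cos y < cos z := cos_lt_cos_of_nonneg_of_le_pi_div_two hz'.1.le hy hz.2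
  have : 0 < k * cos z + 2 - k ^ 2 := by nlinarith
  positivity

/-- The slope decreases once `k * cos t + 2 - k ^ 2` is nonpositive. -/
lemma logSubCotSlope_lt_of_nonpos {k x y : ℝ} (hk : 0 < k) (hx : 0 ≤ x) (hxy : x < y)
    (hy : y ≤ π / 2) (h : k * cos x + 2 - k ^ 2 ≤ 0) :
    logSubCotSlope k y < logSubCotSlope k x := by
  refine strictAntiOn_of_deriv_neg (convex_Icc x y)
    ((continuousOn_logSubCotSlope hk).mono (Icc_subset_Icc hx hy)) (fun z hz => ?_)
    (left_mem_Icc.2 hxy.le) (right_mem_Icc.2 hxy.le) hxy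
  rw [interior_Icc] at hz
  have hz' := Ioo_subset_Ioo hx hy hz
  rw [(hasDerivAt_logSubCotSlope hk (Ioo_subset_Icc_self hz')).deriv]
  have hs : 0 < sin z := sin_pos_of_pos_of_lt_pi hz'.1 (by linarith [hz'.2, pi_pos])
  have hq := one_add_mul_cos_pos hk (Ioo_subset_Icc_self hz')
  have hc : cos z < cos x := cos_lt_cos_of_nonneg_of_le_pi_div_two hx hz'.2.le hz.1
  have : k * cos z + 2 - k ^ 2 < 0 := by nlinarith
  exact div_neg_of_neg_of_pos (mul_neg_of_pos_of_neg (by positivity) this) (by positivity)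

lemma logSubCot_zero (k : ℝ) : logSubCot k 0 = log (1 + k) - 1 := by simp [logSubCot]

lemma logSubCot_pi_div_two (k : ℝ) : logSubCot k (π / 2) = 0 := by simp [logSubCot]

lemma logSubCotSlope_zero (k : ℝ) : logSubCotSlope k 0 = 0 := by simp [logSubCotSlope]

lemma logSubCot_two_lt {t : ℝ} (ht : t ∈ Ioo 0 (π / 2)) : logSubCot 2 t < log 3 - 1 := by
  have h := logSubCot_lt_of_slope_neg two_pos le_rfl ht.1 ht.2.le fun z hz => by
    have := logSubCotSlope_lt_of_nonpos two_pos le_rfl hz.1 (hz.2.trans ht.2).le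
      (by norm_num)
    rwa [logSubCotSlope_zero] at this
  rw [logSubCot_zero] at h
  norm_num at h ⊢
  exact h

/-- `logSubCot k` is positive inside the interval when it is nonnegative at the left end. -/
lemma logSubCot_pos {k t : ℝ} (hk : 0 < k) (hk' : 1 ≤ log (1 + k)) (ht : t ∈ Ioo 0 (π / 2)) :
    0 < logSubCot k t := by
  have slope_pos {x : ℝ} (hx : x ∈ Ioo 0 (π / 2)) (h : 0 ≤ k * cos x + 2 - k ^ 2) :
      0 < logSubCotSlope k x := by
    simpa [logSubCotSlope_zero] using logSubCotSlope_lt_of_nonneg hk le_rfl hx.1 hx.2.le h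
  rcases le_or_gt 0 (logSubCotSlope k t) with hR | hR
  · have h := logSubCot_lt_of_slope_pos hk le_rfl ht.1 ht.2.le fun x hx => by
      rcases le_or_gt 0 (k * cos x + 2 - k ^ 2) with hc | hc
      · exact slope_pos ⟨hx.1, hx.2.trans ht.2⟩ hc
      · exact hR.trans_lt (logSubCotSlope_lt_of_nonpos hk hx.1.le hx.2 ht.2.le hc.le)
    rw [logSubCot_zero] at h
    linarith
  · have hc : k * cos t + 2 - k ^ 2 < 0 := by
      by_contra! hc
      exact hR.not_gt (slope_pos ht hc)
    have h := logSubCot_lt_of_slope_neg hk ht.1.le ht.2 le_rfl fun x hx =>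
      (logSubCotSlope_lt_of_nonpos hk ht.1.le hx.1 hx.2.le hc.le).trans hR
    rwa [logSubCot_pi_div_two] at h

lemma two_thirds_mul_cos_add_lt_exp {t : ℝ} (ht : t ∈ Ioo 0 (π / 2)) :
    2 / 3 * cos t + 1 / 3 < exp (cos t / sinc t - 1) := by
  have hq := one_add_mul_cos_pos two_pos (Ioo_subset_Icc_self ht)
  have h := logSubCot_two_lt ht
  rw [show 2 / 3 * cos t + 1 / 3 = (1 + 2 * cos t) / 3 by ring,
    ← log_lt_iff_lt_exp (by positivity), log_div hq.ne' (by norm_num)]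
  unfold logSubCot at h
  linarith

lemma exp_lt_mul_cos_add {t : ℝ} (ht : t ∈ Ioo 0 (π / 2)) :
    exp (cos t / sinc t - 1) < (exp 1 - 1) / exp 1 * cos t + 1 / exp 1 := by
  have hk : 0 < exp 1 - 1 := by linarith [one_lt_exp_iff.2 one_pos]
  have hq := one_add_mul_cos_pos hk (Ioo_subset_Icc_self ht)
  have h := logSubCot_pos hk (by simp) ht
  have h' : exp (cos t / sinc t) < 1 + (exp 1 - 1) * cos t := by
    rw [← lt_log_iff_exp_lt hq]
    unfold logSubCot at h
    linarith
  rw [exp_sub, show (exp 1 - 1) / exp 1 * cos t + 1 / exp 1 =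
    (1 + (exp 1 - 1) * cos t) / exp 1 by ring]
  gcongr

lemma Am_comm (a b : ℝ) : Am a b = Am b a := by simp only [Am, add_comm]

lemma Gm_comm (a b : ℝ) : Gm a b = Gm b a := by simp only [Gm, mul_comm]

lemma Pm_comm (a b : ℝ) : Pm a b = Pm b a := by
  unfold Pm
  rw [← neg_sub b a, add_comm a b, neg_div (b + a), arcsin_neg, mul_neg,
    neg_div_neg_eq]

lemma Xm_comm (a b : ℝ) : Xm a b = Xm b a := by
  simp only [Xm, Am_comm a b, Gm_comm a b, Pm_comm a b]

lemma arcsin_sub_div_add_mem_Ioo {a b : ℝ} (hb : 0 < b) (hba : b < a) :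
    arcsin ((a - b) / (a + b)) ∈ Ioo 0 (π / 2) := by
  have hs : 0 < a + b := by linarith
  refine ⟨arcsin_pos.2 (div_pos (sub_pos.2 hba) hs), arcsin_lt_pi_div_two.2 ?_⟩
  rw [div_lt_one hs]
  linarith

lemma Gm_eq_Am_mul_cos {a b : ℝ} (ha : 0 < a) (hb : 0 < b) :
    Gm a b = Am a b * cos (arcsin ((a - b) / (a + b))) := by
  unfold Gm Am
  rw [cos_arcsin, show a * b = ((a + b) / 2) ^ 2 * (1 - ((a - b) / (a + b)) ^ 2) by
    field_simp; ring, sqrt_mul (by positivity), sqrt_sq (by positivity)]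

lemma Pm_eq_Am_mul_sinc {a b : ℝ} (hb : 0 < b) (hba : b < a) :
    Pm a b = Am a b * sinc (arcsin ((a - b) / (a + b))) := by
  have ht := arcsin_sub_div_add_mem_Ioo hb hba
  have hs : 0 < a + b := by linarith
  have h1 : (a - b) / (a + b) ≤ 1 := by rw [div_le_one hs]; linarith
  have h2 : 0 ≤ (a - b) / (a + b) := div_nonneg (sub_pos.2 hba).le hs.le
  have h0 := ht.1.ne'
  rw [sinc_of_ne_zero h0, sin_arcsin (by linarith) h1]
  unfold Pm Am
  field_simp

theorem stmt_0 (a b : ℝ) (ha : 0 < a) (hb : 0 < b) (hab : a ≠ b) :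
    (2 / 3) * Gm a b + (1 / 3) * Am a b < Xm a b ∧
    Xm a b < ((Real.exp 1 - 1) / Real.exp 1) * Gm a b + (1 / Real.exp 1) * Am a b := by
  wlog hba : b < a generalizing a b
  · rw [Gm_comm, Am_comm, Xm_comm]
    exact this b a hb ha hab.symm (hab.lt_or_gt.resolve_right hba)
  have ht := arcsin_sub_div_add_mem_Ioo hb hba
  have hA : 0 < Am a b := by unfold Am; positivity
  rw [Xm, Pm_eq_Am_mul_sinc hb hba, Gm_eq_Am_mul_cos ha hb, mul_div_mul_left _ _ hA.ne']
  constructor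
  · have := mul_lt_mul_of_pos_left (two_thirds_mul_cos_add_lt_exp ht) hA
    linarith
  · have := mul_lt_mul_of_pos_left (exp_lt_mul_cos_add ht) hA
    linarith
end

section
/- For all real numbers a, b > 0 with a ≠ b, one has the chain of inequalities (A+G)/e < X < M_q < (L+I)/2 < (A+G)/2, where q = log 2/(1 + log 2) and e is Euler's number. -/
open Real

open Set Filter Topology

/-- A function on the positive half-line that is not positive at `x`, but is bounded below by a
function tending to `0` at `0`, has a nonpositive derivative somewhere in `(0, x)`. -/
lemma exists_deriv_nonpos {f f' B : ℝ → ℝ} (hd : ∀ x, 0 < x → HasDerivAt f (f' x) x)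
    (hB : ∀ x, 0 < x → B x ≤ f x) (hBc : ContinuousAt B 0) (hB0 : B 0 = 0)
    {x : ℝ} (hx : 0 < x) (hfx : f x ≤ 0) : ∃ c, 0 < c ∧ c < x ∧ f' c ≤ 0 := by
  by_contra! h
  have hmono : StrictMonoOn f (Ioc 0 x) := by
    apply strictMonoOn_of_deriv_pos (convex_Ioc 0 x)
    · exact fun y hy => (hd y hy.1).continuousAt.continuousWithinAt
    · intro y hy
      rw [interior_Ioc] at hy
      rw [(hd y hy.1).deriv]
      exact h y hy.1 hy.2
  have h1 : f (x / 2) < f x := hmono ⟨by linarith, by linarith⟩ ⟨hx, le_rfl⟩ (by linarith)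
  have hlim : Tendsto B (𝓝[>] 0) (𝓝 0) := by
    have := hBc.tendsto
    rw [hB0] at this
    exact this.mono_left nhdsWithin_le_nhds
  have h2 : (0 : ℝ) ≤ f (x / 2) := by
    refine le_of_tendsto hlim ?_
    filter_upwards [Ioo_mem_nhdsGT (show (0 : ℝ) < x / 2 by linarith)] with y hy
    exact (hB y hy.1).trans
      (hmono ⟨hy.1, by linarith [hy.2]⟩ ⟨by linarith, by linarith⟩ hy.2).le
  linarith

/-- A function is positive on the positive half-line if its derivative is and it is bounded below
by a function tending to `0` at `0`. -/
lemma pos_of_deriv_pos_of_minorant {f f' B : ℝ → ℝ} (hd : ∀ x, 0 < x → HasDerivAt f (f' x) x)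
    (hB : ∀ x, 0 < x → B x ≤ f x) (hBc : ContinuousAt B 0) (hB0 : B 0 = 0)
    (hf' : ∀ x, 0 < x → 0 < f' x) {x : ℝ} (hx : 0 < x) : 0 < f x := by
  by_contra! h
  obtain ⟨c, hc, -, hcn⟩ := exists_deriv_nonpos hd hB hBc hB0 hx h
  exact (hf' c hc).not_ge hcn

/-- A differentiable function vanishing at `0` whose derivative is positive on the positive
half-line is positive there. -/
lemma pos_of_hasDerivAt_pos {f f' : ℝ → ℝ} (hd : ∀ x, HasDerivAt f (f' x) x) (h0 : f 0 = 0)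
    (hf' : ∀ x, 0 < x → 0 < f' x) {x : ℝ} (hx : 0 < x) : 0 < f x :=
  pos_of_deriv_pos_of_minorant (B := f) (fun x _ => hd x) (fun _ _ => le_rfl)
    (hd 0).continuousAt h0 hf' hx

/-- On the positive half-line, `f` is positive up to some point and negative afterwards. -/
def CrossesDown (f : ℝ → ℝ) : Prop := ∀ x y, 0 < x → x < y → f x ≤ 0 → f y < 0

/-- If the derivative of `f` crosses zero downwards, then `f` is strictly decreasing from any point
where it is not positive. -/
lemma CrossesDown.strictAntiOn {f f' B : ℝ → ℝ} (hf' : CrossesDown f')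
    (hd : ∀ x, 0 < x → HasDerivAt f (f' x) x)
    (hB : ∀ x, 0 < x → B x ≤ f x) (hBc : ContinuousAt B 0) (hB0 : B 0 = 0)
    {x : ℝ} (hx : 0 < x) (hfx : f x ≤ 0) : StrictAntiOn f (Ici x) := by
  obtain ⟨c, hc, hcx, hc'⟩ := exists_deriv_nonpos hd hB hBc hB0 hx hfx
  apply strictAntiOn_of_deriv_neg (convex_Ici x)
  · exact fun y hy => (hd y (hx.trans_le hy)).continuousAt.continuousWithinAt
  · intro y hy
    rw [interior_Ici] at hy
    have hy' : x < y := hy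
    rw [(hd y (by linarith)).deriv]
    exact hf' c y hc (by linarith) hc'

lemma CrossesDown.of_deriv {f f' B : ℝ → ℝ} (hf' : CrossesDown f')
    (hd : ∀ x, 0 < x → HasDerivAt f (f' x) x)
    (hB : ∀ x, 0 < x → B x ≤ f x) (hBc : ContinuousAt B 0) (hB0 : B 0 = 0) : CrossesDown f := by
  intro x y hx hxy hfx
  have := hf'.strictAntiOn hd hB hBc hB0 hx hfx self_mem_Ici hxy.le hxy
  linarith

/-- The bounds on the exponent `log 2 / (1 + log 2)` used below. -/
lemma exponent_bounds : 4093 / 10000 < log 2 / (1 + log 2) ∧ log 2 / (1 + log 2) < 41 / 100 := by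
  have h1 := Real.log_two_gt_d9
  have h2 := Real.log_two_lt_d9
  constructor
  · rw [lt_div_iff₀ (by linarith)]; linarith
  · rw [div_lt_iff₀ (by linarith)]; linarith

lemma tanh_lt_arctan_sinh {t : ℝ} (ht : 0 < t) : sinh t / cosh t < arctan (sinh t) := by
  have h := Real.sin_lt (Real.arctan_pos.mpr (Real.sinh_pos_iff.mpr ht))
  have hc : √(1 + sinh t ^ 2) = cosh t := by
    rw [← Real.cosh_sq', Real.sqrt_sq (Real.cosh_pos t).le]
  rwa [Real.sin_arctan, hc] at h

lemma cosh_add_one_div_exp_lt {t : ℝ} (ht : 0 < t) :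
    (cosh t + 1) / exp 1 < cosh t * exp (arctan (sinh t) / sinh t - 1) := by
  have hc := Real.cosh_pos t
  have hs := Real.sinh_pos_iff.mpr ht
  have h : 1 / cosh t < arctan (sinh t) / sinh t := by
    rw [lt_div_iff₀ hs]
    calc 1 / cosh t * sinh t = sinh t / cosh t := by ring
      _ < _ := tanh_lt_arctan_sinh ht
  rw [Real.exp_sub, ← mul_div_assoc]
  gcongr
  calc cosh t + 1 = cosh t * (1 / cosh t + 1) := by field_simp; ring
    _ < cosh t * exp (arctan (sinh t) / sinh t) := by
      gcongr
      linarith [Real.add_one_le_exp (arctan (sinh t) / sinh t)]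

lemma mul_cosh_sub_sinh_pos {t : ℝ} (ht : 0 < t) : 0 < t * cosh t - sinh t := by
  refine pos_of_hasDerivAt_pos (f := fun t => t * cosh t - sinh t) (f' := fun t => t * sinh t)
    (fun x => ?_) (by simp) (fun x hx => mul_pos hx (Real.sinh_pos_iff.mpr hx)) ht
  refine HasDerivAt.congr_deriv (((hasDerivAt_id x).mul (Real.hasDerivAt_cosh x)).sub
    (Real.hasDerivAt_sinh x)) ?_
  simp

lemma sq_half_lt_cosh_sub_one {t : ℝ} (ht : 0 < t) : 0 < cosh t - 1 - t ^ 2 / 2 := by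
  refine pos_of_hasDerivAt_pos (f := fun t => cosh t - 1 - t ^ 2 / 2) (f' := fun t => sinh t - t)
    (fun x => ?_) (by simp) (fun x hx => sub_pos.mpr (Real.self_lt_sinh_iff.mpr hx)) ht
  refine HasDerivAt.congr_deriv (((Real.hasDerivAt_cosh x).sub_const 1).sub
    ((hasDerivAt_pow 2 x).div_const 2)) ?_
  simp

/-- The hyperbolic Wilker inequality, cleared of denominators. -/
lemma sinh_wilker {t : ℝ} (ht : 0 < t) :
    0 < sinh t ^ 2 + t * sinh t - (cosh t + 1) * t ^ 2 := by
  refine pos_of_hasDerivAt_pos (f := fun t => sinh t ^ 2 + t * sinh t - (cosh t + 1) * t ^ 2)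
    (f' := fun t => 2 * sinh t * cosh t + sinh t - t * cosh t - 2 * t - t ^ 2 * sinh t)
    (fun x => ?_) (by simp) (fun x hx => ?_) ht
  · refine HasDerivAt.congr_deriv ((((Real.hasDerivAt_sinh x).pow 2).add
      ((hasDerivAt_id x).mul (Real.hasDerivAt_sinh x))).sub
      (((Real.hasDerivAt_cosh x).add_const 1).mul (hasDerivAt_pow 2 x))) ?_
    simp
    ring
  refine pos_of_hasDerivAt_pos
    (f := fun t => 2 * sinh t * cosh t + sinh t - t * cosh t - 2 * t - t ^ 2 * sinh t)
    (f' := fun t => 4 * sinh t ^ 2 - 3 * t * sinh t - t ^ 2 * cosh t)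
    (fun x => ?_) (by simp) (fun x hx => ?_) hx
  · refine HasDerivAt.congr_deriv ((((((((Real.hasDerivAt_sinh x).const_mul 2).mul
      (Real.hasDerivAt_cosh x)).add
      (Real.hasDerivAt_sinh x)).sub ((hasDerivAt_id x).mul (Real.hasDerivAt_cosh x))).sub
      ((hasDerivAt_id x).const_mul 2)).sub
      ((hasDerivAt_pow 2 x).mul (Real.hasDerivAt_sinh x)))) ?_
    simp
    linear_combination 2 * Real.cosh_sq x
  refine pos_of_hasDerivAt_pos
    (f := fun t => 4 * sinh t ^ 2 - 3 * t * sinh t - t ^ 2 * cosh t)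
    (f' := fun t => 8 * sinh t * cosh t - 3 * sinh t - 5 * t * cosh t - t ^ 2 * sinh t)
    (fun x => ?_) (by simp) (fun x hx => ?_) hx
  · refine HasDerivAt.congr_deriv (((((Real.hasDerivAt_sinh x).pow 2).const_mul 4).sub
      (((hasDerivAt_id x).const_mul 3).mul (Real.hasDerivAt_sinh x))).sub
      ((hasDerivAt_pow 2 x).mul (Real.hasDerivAt_cosh x))) ?_
    simp
    ring
  · have h1 := Real.self_lt_sinh_iff.mpr hx
    have h2 := sq_half_lt_cosh_sub_one hx
    have h3 : 0 < (sinh x - x) * cosh x := mul_pos (by linarith) (Real.cosh_pos x)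
    have h4 : 0 < sinh x * (3 * cosh x - 3 - x ^ 2) := mul_pos (by linarith) (by nlinarith)
    nlinarith

lemma hasDerivAt_mul_coth {x : ℝ} (hx : 0 < x) :
    HasDerivAt (fun t => t * cosh t / sinh t)
      ((sinh x * cosh x - x) / sinh x ^ 2) x := by
  have hs := Real.sinh_pos_iff.mpr hx
  refine HasDerivAt.congr_deriv (((hasDerivAt_id x).mul (Real.hasDerivAt_cosh x)).div
    (Real.hasDerivAt_sinh x) hs.ne') ?_
  simp
  congr 1
  linear_combination (-x) * Real.cosh_sq x

/-- The inequality `L + I < A + G` for the means of `exp t` and `exp (-t)`. -/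
lemma sinh_div_add_exp_lt {t : ℝ} (ht : 0 < t) :
    sinh t / t + exp (t * cosh t / sinh t - 1) < cosh t + 1 := by
  have hN : ∀ x : ℝ, 0 < x → 1 < 1 + cosh x - sinh x / x := fun x hx => by
    have : sinh x / x < cosh x := by
      rw [div_lt_iff₀ hx]; linarith [mul_cosh_sub_sinh_pos hx]
    linarith
  have key : 0 < log (1 + cosh t - sinh t / t) - (t * cosh t / sinh t - 1) := by
    refine pos_of_deriv_pos_of_minorant
      (f := fun t => log (1 + cosh t - sinh t / t) - (t * cosh t / sinh t - 1))
      (f' := fun x => (sinh x - (cosh x * x - sinh x * 1) / x ^ 2) / (1 + cosh x - sinh x / x)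
        - (sinh x * cosh x - x) / sinh x ^ 2)
      (B := fun t => 1 - cosh t) (fun x hx => ?_) (fun x hx => ?_) ?_ (by simp) (fun x hx => ?_) ht
    · exact ((((Real.hasDerivAt_cosh x).const_add 1).sub
        ((Real.hasDerivAt_sinh x).div (hasDerivAt_id x) hx.ne')).log
          (zero_lt_one.trans (hN x hx)).ne').sub ((hasDerivAt_mul_coth hx).sub_const 1)
    · have h1 := Real.log_nonneg (hN x hx).le
      have hs := Real.sinh_pos_iff.mpr hx
      have h2 : x * cosh x / sinh x ≤ cosh x := by
        rw [div_le_iff₀ hs]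
        nlinarith [Real.self_lt_sinh_iff.mpr hx, Real.cosh_pos x]
      linarith
    · fun_prop
    · have hs := Real.sinh_pos_iff.mpr hx
      have h1 := hN x hx
      have h2 := sinh_wilker hx
      have h3 := Real.self_lt_sinh_iff.mpr hx
      rw [sub_pos, div_lt_div_iff₀ (by positivity) (by linarith)]
      have h4 : 0 < (sinh x - x) * (sinh x ^ 2 + x * sinh x - (cosh x + 1) * x ^ 2) / x ^ 2 := by
        have := mul_pos (sub_pos.mpr h3) h2
        positivity
      have h5 : (sinh x - (cosh x * x - sinh x * 1) / x ^ 2) * sinh x ^ 2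
          - (sinh x * cosh x - x) * (1 + cosh x - sinh x / x)
          = (sinh x - x) * (sinh x ^ 2 + x * sinh x - (cosh x + 1) * x ^ 2) / x ^ 2 := by
        field_simp
        linear_combination (-(x ^ 2 * sinh x)) * Real.cosh_sq x
      linarith
  have h := hN t ht
  have h2 : exp (t * cosh t / sinh t - 1) < 1 + cosh t - sinh t / t := by
    rw [← Real.lt_log_iff_exp_lt (by linarith)]
    linarith
  linarith

lemma lt_mul_coth {t : ℝ} (ht : 0 < t) :
    t ^ 2 / 3 - t ^ 4 / 45 < t * cosh t / sinh t - 1 := by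
  have key : 0 < t * cosh t - (1 + t ^ 2 / 3 - t ^ 4 / 45) * sinh t := by
    refine pos_of_hasDerivAt_pos
      (f := fun t => t * cosh t - (1 + t ^ 2 / 3 - t ^ 4 / 45) * sinh t)
      (f' := fun t => t * ((1 / 3 + 4 * t ^ 2 / 45) * sinh t - (t / 3 - t ^ 3 / 45) * cosh t))
      (fun x => ?_) (by simp) (fun x hx => mul_pos hx ?_) ht
    · refine HasDerivAt.congr_deriv (((hasDerivAt_id x).mul (Real.hasDerivAt_cosh x)).sub
        (((((hasDerivAt_pow 2 x).div_const 3).const_add 1).sub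
          ((hasDerivAt_pow 4 x).div_const 45)).mul (Real.hasDerivAt_sinh x))) ?_
      simp
      ring
    · refine pos_of_hasDerivAt_pos
        (f := fun t => (1 / 3 + 4 * t ^ 2 / 45) * sinh t - (t / 3 - t ^ 3 / 45) * cosh t)
        (f' := fun t => 7 * t / 45 * (t * cosh t - sinh t) + t ^ 3 / 45 * sinh t)
        (fun x => ?_) (by simp) (fun x hx => ?_) hx
      · refine HasDerivAt.congr_deriv
          ((((((hasDerivAt_pow 2 x).const_mul 4).div_const 45).const_add (1 / 3)).mul
            (Real.hasDerivAt_sinh x)).sub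
          ((((hasDerivAt_id x).div_const 3).sub ((hasDerivAt_pow 3 x).div_const 45)).mul
            (Real.hasDerivAt_cosh x))) ?_
        simp
        ring
      · have h1 := mul_cosh_sub_sinh_pos hx
        have h2 := Real.sinh_pos_iff.mpr hx
        positivity
  have hs := Real.sinh_pos_iff.mpr ht
  have : 1 + t ^ 2 / 3 - t ^ 4 / 45 < t * cosh t / sinh t := by
    rw [lt_div_iff₀ hs]; linarith
  linarith

lemma lt_log_sinh_div {t : ℝ} (ht : 0 < t) : t ^ 2 / 6 - t ^ 4 / 180 < log (sinh t / t) := by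
  rw [Real.log_div (Real.sinh_pos_iff.mpr ht).ne' ht.ne', ← sub_pos]
  refine pos_of_deriv_pos_of_minorant
    (f := fun t => log (sinh t) - log t - (t ^ 2 / 6 - t ^ 4 / 180))
    (f' := fun t => cosh t / sinh t - t⁻¹ - (t / 3 - t ^ 3 / 45))
    (B := fun t => - (t ^ 2 / 6 - t ^ 4 / 180)) (fun x hx => ?_) (fun x hx => ?_) (by fun_prop)
    (by simp) (fun x hx => ?_) ht
  · refine HasDerivAt.congr_deriv
      ((((Real.hasDerivAt_sinh x).log (Real.sinh_pos_iff.mpr hx).ne').sub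
        (Real.hasDerivAt_log hx.ne')).sub
        (((hasDerivAt_pow 2 x).div_const 6).sub ((hasDerivAt_pow 4 x).div_const 180))) ?_
    simp
    ring
  · have := Real.log_le_log hx (Real.self_lt_sinh_iff.mpr hx).le
    linarith
  · have h := mul_pos (inv_pos.mpr hx) (sub_pos.mpr (lt_mul_coth hx))
    have hs := (Real.sinh_pos_iff.mpr hx).ne'
    refine h.trans_eq ?_
    field_simp

lemma exp_half_add_le (x y : ℝ) : exp ((x + y) / 2) ≤ (exp x + exp y) / 2 := by
  have hx : exp x = exp (x / 2) ^ 2 := by rw [← Real.exp_nat_mul]; congr 1; push_cast; ring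
  have hy : exp y = exp (y / 2) ^ 2 := by rw [← Real.exp_nat_mul]; congr 1; push_cast; ring
  rw [hx, hy, add_div, Real.exp_add]
  nlinarith [sq_nonneg (exp (x / 2) - exp (y / 2))]

lemma cosh_rpow_lt_of_sq_le {t q : ℝ} (ht : 0 < t) (ht3 : t ^ 2 ≤ 3) (hq0 : 0 < q)
    (hq : q < 41 / 100) :
    cosh (q * t) ^ (1 / q) < (sinh t / t + exp (t * cosh t / sinh t - 1)) / 2 := by
  have h1 : cosh (q * t) ^ (1 / q) ≤ exp (q * t ^ 2 / 2) := by
    calc cosh (q * t) ^ (1 / q) ≤ exp ((q * t) ^ 2 / 2) ^ (1 / q) := by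
          gcongr
          exact Real.cosh_le_exp_half_sq _
      _ = exp (q * t ^ 2 / 2) := by
          rw [← Real.exp_mul]
          congr 1
          field_simp
  have hL : 0 < sinh t / t := div_pos (Real.sinh_pos_iff.mpr ht) ht
  have h2 := exp_half_add_le (log (sinh t / t)) (t * cosh t / sinh t - 1)
  rw [Real.exp_log hL] at h2
  refine (h1.trans_lt (Real.exp_lt_exp.mpr ?_)).trans_le h2
  have h3 := lt_log_sinh_div ht
  have h4 := lt_mul_coth ht
  have h5 : 0 < t ^ 2 := by positivity
  nlinarith

lemma cosh_eq_exp_mul (x : ℝ) : cosh x = exp x / 2 * (1 + exp (-2 * x)) := by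
  rw [Real.cosh_eq, mul_add, mul_one, div_mul_eq_mul_div, ← Real.exp_add]
  ring_nf

/-- A chord bound for the convex function `(1 + u) ^ r`. -/
lemma one_add_rpow_le {r u : ℝ} (hr1 : 1 ≤ r) (hr : r ≤ 22 / 9) (hu : 0 ≤ u) (hu4 : u ≤ 1 / 4) :
    (1 + u) ^ r ≤ 1 + 29024 / 10000 * u := by
  have h1 : (5 / 4 : ℝ) ^ r ≤ 17256 / 10000 := by
    calc (5 / 4 : ℝ) ^ r ≤ (5 / 4 : ℝ) ^ (22 / 9 : ℝ) :=
          Real.rpow_le_rpow_of_exponent_le (by norm_num) hr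
      _ = ((5 / 4 : ℝ) ^ (22 : ℕ)) ^ (1 / 9 : ℝ) := by
          rw [← Real.rpow_natCast, ← Real.rpow_mul (by norm_num)]
          norm_num
      _ ≤ ((17256 / 10000 : ℝ) ^ (9 : ℕ)) ^ (1 / 9 : ℝ) := by
          gcongr
          norm_num
      _ = 17256 / 10000 := by
          rw [← Real.rpow_natCast, ← Real.rpow_mul (by norm_num)]
          norm_num
  have h2 := (convexOn_rpow hr1).2 (show (1 : ℝ) ∈ Ici 0 by simp)
    (show (5 / 4 : ℝ) ∈ Ici 0 by norm_num [mem_Ici])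
    (show 0 ≤ 1 - 4 * u by linarith) (show 0 ≤ 4 * u by linarith) (by ring)
  simp only [smul_eq_mul, Real.one_rpow, mul_one] at h2
  rw [show 1 - 4 * u + 4 * u * (5 / 4) = 1 + u by ring] at h2
  nlinarith

lemma cosh_rpow_eq (t : ℝ) :
    cosh (log 2 / (1 + log 2) * t) ^ (1 / (log 2 / (1 + log 2))) =
      exp (t - 1) / 2 * (1 + exp (-2 * (log 2 / (1 + log 2) * t))) ^
        (1 / (log 2 / (1 + log 2))) := by
  have hl := Real.log_pos one_lt_two
  rw [cosh_eq_exp_mul, Real.mul_rpow (by positivity) (by positivity),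
    Real.div_rpow (by positivity) (by positivity), ← Real.exp_mul,
    Real.rpow_def_of_pos two_pos]
  have h1 : log 2 / (1 + log 2) * t * (1 / (log 2 / (1 + log 2))) = t := by field_simp
  have h2 : log 2 * (1 / (log 2 / (1 + log 2))) = 1 + log 2 := by field_simp
  rw [h1, h2, Real.exp_add, Real.exp_log two_pos, Real.exp_sub, div_div]

lemma cosh_rpow_lt_of_le_sq {t : ℝ} (ht : 0 < t) (ht3 : 3 ≤ t ^ 2) :
    cosh (log 2 / (1 + log 2) * t) ^ (1 / (log 2 / (1 + log 2))) <
      (sinh t / t + exp (t * cosh t / sinh t - 1)) / 2 := by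
  rw [cosh_rpow_eq]
  obtain ⟨hq, hq'⟩ := exponent_bounds
  set q := log 2 / (1 + log 2)
  have hq0 : 0 < q := by linarith
  have ht' : 173 / 100 < t := by nlinarith
  have hs := Real.sinh_pos_iff.mpr ht
  set u := exp (-2 * (q * t)) with hu
  have hu0 : 0 < u := Real.exp_pos _
  have hu4 : u ≤ 1 / 4 := by
    rw [show (1 / 4 : ℝ) = exp (-(2 * log 2)) by
      rw [Real.exp_neg, two_mul, Real.exp_add, Real.exp_log two_pos]; norm_num]
    apply Real.exp_le_exp.mpr
    nlinarith [Real.log_two_lt_d9]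
  have hpow := one_add_rpow_le (r := 1 / q) (by rw [le_div_iff₀ hq0]; linarith)
    (by rw [div_le_iff₀ hq0]; linarith) hu0.le hu4
  have hI : exp (t - 1) ≤ exp (t * cosh t / sinh t - 1) := by
    gcongr
    rw [le_div_iff₀ hs]
    exact mul_le_mul_of_nonneg_left (Real.sinh_lt_cosh t).le ht.le
  have he := Real.exp_one_gt_d9
  have hut : 2 * (q * t) * u * exp 1 ≤ 1 := by
    have h := Real.add_one_le_exp (2 * (q * t) - 1)
    have h' : exp (2 * (q * t) - 1) * (u * exp 1) = 1 := by
      rw [hu, ← Real.exp_add, ← Real.exp_add]; ring_nf; exact Real.exp_zero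
    have : 0 < u * exp 1 := by positivity
    nlinarith
  have hE : exp (-2 * t) ≤ 1 / 29 := by
    have h3 : exp (3 : ℝ) = exp 1 ^ 3 := by rw [← Real.exp_nat_mul]; norm_num
    have h3' : (20 : ℝ) ≤ exp 3 := by
      rw [h3]
      calc (20 : ℝ) ≤ 2.718281828 ^ 3 := by norm_num
        _ ≤ _ := by gcongr; linarith
    have h4 := Real.add_one_le_exp (2 * t - 3)
    have h5 : exp (2 * t) = exp 3 * exp (2 * t - 3) := by rw [← Real.exp_add]; ring_nf
    have h6 : 29 ≤ exp (2 * t) := by rw [h5]; nlinarith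
    rw [show -2 * t = -(2 * t) by ring, Real.exp_neg, ← one_div]
    exact one_div_le_one_div_of_le (by norm_num) h6
  have hL : sinh t / t = exp (t - 1) * (exp 1 * (1 - exp (-2 * t)) / (2 * t)) := by
    have h1 : exp (t - 1) * exp 1 = exp t := by rw [← Real.exp_add]; ring_nf
    have h2 : exp t * exp (-2 * t) = exp (-t) := by rw [← Real.exp_add]; ring_nf
    rw [Real.sinh_eq, ← h2, ← h1]
    ring
  have hmain : 29024 / 10000 * u < exp 1 * (1 - exp (-2 * t)) / (2 * t) := by
    rw [lt_div_iff₀ (by linarith)]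
    have h1 : 29024 / 10000 < q * exp 1 ^ 2 * (1 - exp (-2 * t)) := by
      calc (29024 / 10000 : ℝ) < 4093 / 10000 * 2.718281828 ^ 2 * (1 - 1 / 29) := by norm_num
        _ ≤ q * exp 1 ^ 2 * (1 - exp (-2 * t)) := by gcongr; linarith
    have h2 : 0 < q * exp 1 := by positivity
    refine lt_of_mul_lt_mul_left ?_ h2.le
    nlinarith
  have hE0 := Real.exp_pos (t - 1)
  rw [hL]
  nlinarith

lemma cosh_rpow_lt {t : ℝ} (ht : 0 < t) :
    cosh (log 2 / (1 + log 2) * t) ^ (1 / (log 2 / (1 + log 2))) <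
      (sinh t / t + exp (t * cosh t / sinh t - 1)) / 2 := by
  rcases le_total (t ^ 2) 3 with h | h
  · exact cosh_rpow_lt_of_sq_le ht h (by linarith [exponent_bounds.1]) exponent_bounds.2
  · exact cosh_rpow_lt_of_le_sq ht h

/-- The mixed hyperbolic sine sum controlling the comparison of `X` with the power mean. -/
lemma crossesDown_sinh_sum {q : ℝ} (hq0 : 1 / 3 < q) (hq : q < 41 / 100) :
    CrossesDown fun x => 3 * sinh (q * x) - sinh ((1 - q) * x) - (1 - 2 * q) * sinh x := by
  have hlin : ∀ k x : ℝ, HasDerivAt (fun y => k * y) k x := fun k x => by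
    simpa using (hasDerivAt_id x).const_mul k
  have h2 : CrossesDown fun x => 3 * (q ^ 2 * sinh (q * x)) - (1 - q) ^ 2 * sinh ((1 - q) * x)
      - (1 - 2 * q) * sinh x := by
    intro x y hx hxy _
    have hy : 0 < y := hx.trans hxy
    have hs : 0 < sinh (q * y) := Real.sinh_pos_iff.mpr (by positivity)
    have h3 : sinh (q * y) ≤ sinh ((1 - q) * y) := Real.sinh_le_sinh.mpr (by nlinarith)
    have h4 : sinh (q * y) ≤ sinh y := Real.sinh_le_sinh.mpr (by nlinarith)
    have h5 : (1 - q) ^ 2 * sinh (q * y) ≤ (1 - q) ^ 2 * sinh ((1 - q) * y) := by gcongr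
    have h6 : (1 - 2 * q) * sinh (q * y) ≤ (1 - 2 * q) * sinh y :=
      mul_le_mul_of_nonneg_left h4 (by linarith)
    have h7 : (3 * q ^ 2 - (1 - q) ^ 2 - (1 - 2 * q)) * sinh (q * y) < 0 :=
      mul_neg_of_neg_of_pos (by nlinarith) hs
    simp only
    linarith
  have h1 : CrossesDown fun x => 3 * (q * cosh (q * x)) - (1 - q) * cosh ((1 - q) * x)
      - (1 - 2 * q) * cosh x := by
    refine h2.of_deriv (B := fun x => 3 * (q * cosh (q * x)) - (1 - q) * cosh ((1 - q) * x)
      - (1 - 2 * q) * cosh x - (6 * q - 2)) (fun x _ => ?_) (fun x _ => by linarith)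
      (by fun_prop) (by simp; ring)
    refine HasDerivAt.congr_deriv ((((((hlin q x).cosh).const_mul q).const_mul 3).sub
      (((hlin (1 - q) x).cosh).const_mul (1 - q))).sub
      ((Real.hasDerivAt_cosh x).const_mul (1 - 2 * q))) ?_
    ring
  refine h1.of_deriv (B := fun x => 3 * sinh (q * x) - sinh ((1 - q) * x) - (1 - 2 * q) * sinh x)
    (fun x _ => ?_) (fun x _ => le_rfl) (by fun_prop) (by simp)
  refine HasDerivAt.congr_deriv ((((hlin q x).sinh.const_mul 3).sub (hlin (1 - q) x).sinh).sub
    ((Real.hasDerivAt_sinh x).const_mul (1 - 2 * q))) ?_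
  ring

lemma CrossesDown.pos_mul {f w : ℝ → ℝ} (hf : CrossesDown f) (hw : ∀ x, 0 < x → 0 < w x) :
    CrossesDown fun x => w x * f x := by
  intro x y hx hxy h
  exact mul_neg_of_pos_of_neg (hw y (hx.trans hxy))
    (hf x y hx hxy (nonpos_of_mul_nonpos_right h (hw x hx)))

lemma hasDerivAt_arctan_sinh (x : ℝ) :
    HasDerivAt (fun t => arctan (sinh t)) (1 / cosh x) x := by
  refine HasDerivAt.congr_deriv (Real.hasDerivAt_sinh x).arctan ?_
  rw [← Real.cosh_sq']
  field_simp

lemma crossesDown_arctan_sinh {q : ℝ} (hq0 : 1 / 3 < q) (hq : q < 41 / 100) :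
    CrossesDown fun t =>
      arctan (sinh t) - sinh t + sinh (q * t) / cosh (q * t) * (sinh t ^ 2 / cosh t) := by
  have hH : CrossesDown fun t => 3 * sinh (q * (2 * t)) - sinh ((1 - q) * (2 * t))
      - (1 - 2 * q) * sinh (2 * t) := fun x y hx hxy h =>
    crossesDown_sinh_sum hq0 hq (2 * x) (2 * y) (by linarith) (by linarith) h
  have hE' := hH.pos_mul (w := fun t => sinh t / (4 * cosh t ^ 2 * cosh (q * t) ^ 2))
    fun x hx => div_pos (Real.sinh_pos_iff.mpr hx) (by positivity)
  refine hE'.of_deriv (B := fun t =>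
      arctan (sinh t) - sinh t + sinh (q * t) / cosh (q * t) * (sinh t ^ 2 / cosh t))
    (fun x _ => ?_) (fun x _ => le_rfl) ?_ (by simp)
  · have hlin : HasDerivAt (fun y => q * y) q x := by
      simpa using (hasDerivAt_id x).const_mul q
    have hc := Real.cosh_pos x
    have hcq := Real.cosh_pos (q * x)
    refine HasDerivAt.congr_deriv (((hasDerivAt_arctan_sinh x).sub (Real.hasDerivAt_sinh x)).add
      ((hlin.sinh.div hlin.cosh hcq.ne').mul
        (((Real.hasDerivAt_sinh x).pow 2).div (Real.hasDerivAt_cosh x) hc.ne'))) ?_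
    have e1 : q * (2 * x) = 2 * (q * x) := by ring
    have e2 : (1 - q) * (2 * x) = 2 * x - 2 * (q * x) := by ring
    rw [e1, e2, Real.sinh_sub, Real.sinh_two_mul, Real.sinh_two_mul, Real.cosh_two_mul,
      Real.cosh_two_mul]
    have i1 := Real.cosh_sq x
    have i2 := Real.cosh_sq (q * x)
    simp
    field_simp
    linear_combination (6 * sinh x * cosh (q * x) * sinh (q * x)
      - 4 * cosh x * cosh (q * x) ^ 2) * i1
      + cosh x * (4 * q * sinh x ^ 2 - 2 * sinh x ^ 2) * i2
  · refine ContinuousAt.add (by fun_prop) (ContinuousAt.mul (ContinuousAt.div (by fun_prop)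
      (by fun_prop) (by simp)) (ContinuousAt.div (by fun_prop) (by fun_prop) (by simp)))

lemma arctan_sinh_le {x : ℝ} (hx : 0 < x) : arctan (sinh x) ≤ sinh x := by
  refine sub_nonneg.mp (pos_of_hasDerivAt_pos (f := fun t => sinh t - arctan (sinh t))
    (fun y => (Real.hasDerivAt_sinh y).sub (hasDerivAt_arctan_sinh y)) (by simp)
    (fun y hy => ?_) hx).le
  have := Real.one_lt_cosh.mpr hy.ne'
  rw [sub_pos, div_lt_iff₀ (by linarith)]
  nlinarith

lemma log_cosh_add_lt {t : ℝ} (ht : 0 < t) :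
    0 < log (cosh (log 2 / (1 + log 2) * t)) / (log 2 / (1 + log 2)) - log (cosh t)
      - (arctan (sinh t) / sinh t - 1) := by
  have hl := Real.log_pos one_lt_two
  obtain ⟨hq, hq'⟩ := exponent_bounds
  have hlog : log 2 / (log 2 / (1 + log 2)) = 1 + log 2 := by field_simp
  set q := log 2 / (1 + log 2)
  have hq0 : 0 < q := by linarith
  set D : ℝ → ℝ := fun t => log (cosh (q * t)) / q - log (cosh t) - (arctan (sinh t) / sinh t - 1)
    with hD
  by_contra! hneg
  have hD' : CrossesDown fun t => cosh t / sinh t ^ 2 * (arctan (sinh t) - sinh t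
      + sinh (q * t) / cosh (q * t) * (sinh t ^ 2 / cosh t)) :=
    (crossesDown_arctan_sinh (by linarith) hq').pos_mul fun x hx =>
      div_pos (Real.cosh_pos x) (pow_pos (Real.sinh_pos_iff.mpr hx) 2)
  have hanti : StrictAntiOn D (Ici t) := by
    refine hD'.strictAntiOn (B := fun t => log (cosh (q * t)) / q - log (cosh t))
      (fun x hx => ?_) (fun x hx => ?_) ?_ (by simp) ht hneg
    · have hlin : HasDerivAt (fun y => q * y) q x := by
        simpa using (hasDerivAt_id x).const_mul q
      have hs := Real.sinh_pos_iff.mpr hx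
      have hc := Real.cosh_pos x
      have hcq := Real.cosh_pos (q * x)
      refine HasDerivAt.congr_deriv ((((hlin.cosh.log hcq.ne').div_const q).sub
        ((Real.hasDerivAt_cosh x).log hc.ne')).sub
        (((hasDerivAt_arctan_sinh x).div (Real.hasDerivAt_sinh x) hs.ne').sub_const 1)) ?_
      have i1 := Real.cosh_sq x
      field_simp
      linear_combination cosh (q * x) * sinh x * i1
    · have hs := Real.sinh_pos_iff.mpr hx
      have : arctan (sinh x) / sinh x ≤ 1 := (div_le_one hs).mpr (arctan_sinh_le hx)
      simp only [hD]
      linarith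
    · exact ((ContinuousAt.log (by fun_prop) (by simp)).div_const q).sub
        (ContinuousAt.log (by fun_prop) (by simp))
  have hlow : ∀ x, 0 < x → -exp (-2 * x) - π / 2 / x ≤ D x := by
    intro x hx
    have h1 : q * x - log 2 ≤ log (cosh (q * x)) := by
      rw [cosh_eq_exp_mul, Real.log_mul (by positivity) (by positivity),
        Real.log_div (by positivity) (by positivity), Real.log_exp]
      have := Real.log_nonneg (le_add_of_nonneg_right (Real.exp_pos (-2 * (q * x))).le)
      linarith
    have h2 : log (cosh x) ≤ x - log 2 + exp (-2 * x) := by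
      rw [cosh_eq_exp_mul, Real.log_mul (by positivity) (by positivity),
        Real.log_div (by positivity) (by positivity), Real.log_exp]
      have := Real.log_le_sub_one_of_pos (show 0 < 1 + exp (-2 * x) by positivity)
      linarith
    have h3 : arctan (sinh x) / sinh x ≤ π / 2 / x :=
      div_le_div₀ (by positivity) (Real.arctan_lt_pi_div_two _).le hx
        (Real.self_lt_sinh_iff.mpr hx).le
    have h4 : x - (1 + log 2) ≤ log (cosh (q * x)) / q := by
      rw [← hlog]
      calc x - log 2 / q = (q * x - log 2) / q := by field_simp
        _ ≤ _ := by gcongr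
    simp only [hD]
    linarith
  have hlim : Tendsto (fun x : ℝ => -exp (-2 * x) - π / 2 / x) atTop (𝓝 0) := by
    have h1 : Tendsto (fun x : ℝ => exp (-2 * x)) atTop (𝓝 0) :=
      Real.tendsto_exp_atBot.comp (tendsto_id.const_mul_atTop_of_neg (by norm_num))
    simpa using h1.neg.sub (tendsto_const_nhds.div_atTop tendsto_id)
  have h1 : D (t + 1) < D t := hanti self_mem_Ici (mem_Ici.mpr (by linarith)) (by linarith)
  have h2 : 0 ≤ D (t + 1) := by
    refine le_of_tendsto hlim ?_
    filter_upwards [eventually_gt_atTop (t + 1)] with x hx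
    exact (hlow x (by linarith)).trans
      (hanti (mem_Ici.mpr (by linarith)) (mem_Ici.mpr (by linarith)) hx).le
  have h3 : D t ≤ 0 := hneg
  linarith

lemma cosh_mul_exp_lt {t : ℝ} (ht : 0 < t) :
    cosh t * exp (arctan (sinh t) / sinh t - 1) <
      cosh (log 2 / (1 + log 2) * t) ^ (1 / (log 2 / (1 + log 2))) := by
  have h := log_cosh_add_lt ht
  rw [Real.rpow_def_of_pos (Real.cosh_pos _), mul_one_div]
  calc cosh t * exp (arctan (sinh t) / sinh t - 1)
      = exp (log (cosh t) + (arctan (sinh t) / sinh t - 1)) := by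
        rw [Real.exp_add, Real.exp_log (Real.cosh_pos t)]
    _ < _ := Real.exp_lt_exp.mpr (by linarith)

lemma mul_exp_sub_mul_exp_neg (g t : ℝ) : g * exp t - g * exp (-t) = 2 * g * sinh t := by
  rw [Real.sinh_eq]; ring

lemma mul_exp_add_mul_exp_neg (g t : ℝ) : g * exp t + g * exp (-t) = 2 * g * cosh t := by
  rw [Real.cosh_eq]; ring

lemma Am_exp (g t : ℝ) : Am (g * exp t) (g * exp (-t)) = g * cosh t := by
  rw [Am, mul_exp_add_mul_exp_neg]; ring

lemma Gm_exp {g : ℝ} (hg : 0 < g) (t : ℝ) : Gm (g * exp t) (g * exp (-t)) = g := by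
  have : g * exp t * (g * exp (-t)) = g ^ 2 * (exp t * exp (-t)) := by ring
  rw [Gm, this, ← Real.exp_add, add_neg_cancel, Real.exp_zero, mul_one, Real.sqrt_sq hg.le]

lemma Pm_exp {g : ℝ} (hg : 0 < g) (t : ℝ) :
    Pm (g * exp t) (g * exp (-t)) = g * sinh t / arctan (sinh t) := by
  have h : arcsin (sinh t / cosh t) = arctan (sinh t) := by
    rw [Real.arctan_eq_arcsin, ← Real.cosh_sq', Real.sqrt_sq (Real.cosh_pos t).le]
  rw [Pm, mul_exp_sub_mul_exp_neg, mul_exp_add_mul_exp_neg,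
    mul_div_mul_left _ _ (by positivity), h, mul_assoc, mul_div_mul_left _ _ two_ne_zero]

lemma Xm_exp {g : ℝ} (hg : 0 < g) (t : ℝ) :
    Xm (g * exp t) (g * exp (-t)) = g * (cosh t * exp (arctan (sinh t) / sinh t - 1)) := by
  rw [Xm, Am_exp, Gm_exp hg, Pm_exp hg, div_div_eq_mul_div, mul_div_mul_left _ _ hg.ne', mul_assoc]

lemma Lm_exp {g : ℝ} (hg : 0 < g) (t : ℝ) :
    Lm (g * exp t) (g * exp (-t)) = g * (sinh t / t) := by
  rw [Lm, mul_exp_sub_mul_exp_neg, Real.log_mul hg.ne' (Real.exp_ne_zero _),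
    Real.log_mul hg.ne' (Real.exp_ne_zero _), Real.log_exp, Real.log_exp,
    show log g + t - (log g + -t) = 2 * t by ring, mul_assoc, mul_div_mul_left _ _ two_ne_zero,
    mul_div_assoc]

lemma Im_exp {g t : ℝ} (hg : 0 < g) (ht : t ≠ 0) :
    Im (g * exp t) (g * exp (-t)) = g * exp (t * cosh t / sinh t - 1) := by
  have hs : sinh t ≠ 0 := Real.sinh_ne_zero.mpr ht
  have h : (log g + t) * (g * exp t) - (log g + -t) * (g * exp (-t)) =
      2 * g * sinh t * (log g + t * cosh t / sinh t) := by
    rw [mul_add, ← mul_exp_sub_mul_exp_neg]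
    have : (g * exp t - g * exp (-t)) * (t * cosh t / sinh t) = t * (2 * g * cosh t) := by
      rw [mul_exp_sub_mul_exp_neg]; field_simp
    rw [this, ← mul_exp_add_mul_exp_neg]
    ring
  rw [Im, Real.rpow_def_of_pos (show 0 < g * exp t by positivity),
    Real.rpow_def_of_pos (show 0 < g * exp (-t) by positivity),
    Real.log_mul hg.ne' (Real.exp_ne_zero _), Real.log_mul hg.ne' (Real.exp_ne_zero _),
    Real.log_exp, Real.log_exp, ← Real.exp_sub, ← Real.exp_mul, h, mul_exp_sub_mul_exp_neg,
    mul_one_div, mul_div_cancel_left₀ _ (by positivity), Real.exp_add, Real.exp_log hg,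
    Real.exp_sub]
  ring

lemma Mp_exp {g q : ℝ} (hg : 0 < g) (hq : q ≠ 0) (t : ℝ) :
    Mp q (g * exp t) (g * exp (-t)) = g * cosh (q * t) ^ (1 / q) := by
  rw [Mp, if_neg hq, Real.mul_rpow hg.le (Real.exp_pos _).le,
    Real.mul_rpow hg.le (Real.exp_pos _).le, ← Real.exp_mul, ← Real.exp_mul, neg_mul, mul_comm t q,
    mul_exp_add_mul_exp_neg, mul_assoc, mul_div_cancel_left₀ _ two_ne_zero,
    Real.mul_rpow (by positivity) (Real.cosh_pos _).le, ← Real.rpow_mul hg.le,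
    mul_one_div_cancel hq, Real.rpow_one]

/-- The chain of inequalities for the means of `exp t` and `exp (-t)`. -/
lemma hyperbolic_chain {t : ℝ} (ht : t ≠ 0) :
    (cosh t + 1) / exp 1 < cosh t * exp (arctan (sinh t) / sinh t - 1) ∧
    cosh t * exp (arctan (sinh t) / sinh t - 1) <
      cosh (log 2 / (1 + log 2) * t) ^ (1 / (log 2 / (1 + log 2))) ∧
    cosh (log 2 / (1 + log 2) * t) ^ (1 / (log 2 / (1 + log 2))) <
      (sinh t / t + exp (t * cosh t / sinh t - 1)) / 2 ∧
    sinh t / t + exp (t * cosh t / sinh t - 1) < cosh t + 1 := by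
  wlog h : 0 < t generalizing t
  · have h' : 0 < -t := by
      have := lt_of_le_of_ne (not_lt.mp h) ht
      linarith
    simpa [neg_div_neg_eq] using this (neg_ne_zero.mpr ht) h'
  · exact ⟨cosh_add_one_div_exp_lt h, cosh_mul_exp_lt h, cosh_rpow_lt h, sinh_div_add_exp_lt h⟩

theorem stmt_2 (a b : ℝ) (ha : 0 < a) (hb : 0 < b) (hab : a ≠ b) :
    (Am a b + Gm a b) / Real.exp 1 < Xm a b ∧
    Xm a b < Mp (Real.log 2 / (1 + Real.log 2)) a b ∧
    Mp (Real.log 2 / (1 + Real.log 2)) a b < (Lm a b + Im a b) / 2 ∧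
    (Lm a b + Im a b) / 2 < (Am a b + Gm a b) / 2 := by
  obtain ⟨g, t, hg, ht, rfl, rfl⟩ :
      ∃ g t : ℝ, 0 < g ∧ t ≠ 0 ∧ a = g * exp t ∧ b = g * exp (-t) := by
    refine ⟨exp ((log a + log b) / 2), (log a - log b) / 2, Real.exp_pos _,
      fun h => hab ?_, ?_, ?_⟩
    · exact Real.log_injOn_pos ha hb (by linarith)
    · rw [← Real.exp_add, ← add_div, show log a + log b + (log a - log b) = 2 * log a by ring,
        mul_div_cancel_left₀ _ two_ne_zero, Real.exp_log ha]
    · rw [← Real.exp_add, ← sub_eq_add_neg, ← sub_div,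
        show log a + log b - (log a - log b) = 2 * log b by ring,
        mul_div_cancel_left₀ _ two_ne_zero, Real.exp_log hb]
  have hq : log 2 / (1 + log 2) ≠ 0 := by
    have := exponent_bounds.1
    positivity
  obtain ⟨h1, h2, h3, h4⟩ := hyperbolic_chain ht
  rw [Am_exp, Gm_exp hg, Xm_exp hg, Lm_exp hg, Im_exp hg ht, Mp_exp hg hq]
  refine ⟨?_, ?_, ?_, ?_⟩
  · calc (g * cosh t + g) / exp 1 = g * ((cosh t + 1) / exp 1) := by ring
      _ < _ := by gcongr
  · gcongr
  · refine (mul_lt_mul_of_pos_left h3 hg).trans_eq ?_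
    ring
  · have := mul_lt_mul_of_pos_left h4 hg
    linarith
end

section
/- For all real numbers a, b > 0 with a ≠ b, one has M_{1/2} < (P+X)/2 < M_k, where k = (5·log 2 + 2)/(6·(log 2 + 1)). -/
open Real

open Set

/-- A function vanishing at `0` with nonnegative derivative on `(0, ∞)` is nonnegative there. -/
lemma nonneg_of_hasDerivAt_nonneg {f f' : ℝ → ℝ} (h0 : f 0 = 0)
    (hf : ∀ x, HasDerivAt f (f' x) x) (hf' : ∀ x, 0 ≤ x → 0 ≤ f' x) {x : ℝ} (hx : 0 ≤ x) :
    0 ≤ f x := by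
  have hmono : MonotoneOn f (Ici 0) := by
    refine monotoneOn_of_deriv_nonneg (convex_Ici 0)
      (fun y _ => (hf y).continuousAt.continuousWithinAt)
      (fun y _ => (hf y).differentiableAt.differentiableWithinAt) fun y hy => ?_
    rw [interior_Ici] at hy
    rw [(hf y).deriv]
    exact hf' y hy.le
  simpa [h0] using hmono self_mem_Ici hx hx

lemma cos_le_taylor_four {x : ℝ} (hx : 0 ≤ x) : cos x ≤ 1 - x ^ 2 / 2 + x ^ 4 / 24 := by
  have := nonneg_of_hasDerivAt_nonneg (f := fun x => 1 - x ^ 2 / 2 + x ^ 4 / 24 - cos x)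
    (f' := fun x => sin x - (x - x ^ 3 / 6)) (by simp)
    (fun y => ?_) (fun y hy => sub_nonneg.2 (sin_ge_sub_cube hy)) hx
  · linarith
  · refine HasDerivAt.congr_deriv (((((hasDerivAt_pow 2 y).div_const 2).const_sub 1).add
      ((hasDerivAt_pow 4 y).div_const 24)).sub (hasDerivAt_cos y)) ?_
    push_cast
    ring

lemma sin_le_taylor_five {x : ℝ} (hx : 0 ≤ x) : sin x ≤ x - x ^ 3 / 6 + x ^ 5 / 120 := by
  have := nonneg_of_hasDerivAt_nonneg (f := fun x => x - x ^ 3 / 6 + x ^ 5 / 120 - sin x)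
    (f' := fun x => 1 - x ^ 2 / 2 + x ^ 4 / 24 - cos x) (by simp)
    (fun y => ?_) (fun y hy => sub_nonneg.2 (cos_le_taylor_four hy)) hx
  · linarith
  · refine HasDerivAt.congr_deriv ((((hasDerivAt_id y).sub ((hasDerivAt_pow 3 y).div_const 6)).add
      ((hasDerivAt_pow 5 y).div_const 120)).sub (hasDerivAt_sin y)) ?_
    push_cast
    ring

lemma taylor_six_le_cos {x : ℝ} (hx : 0 ≤ x) :
    1 - x ^ 2 / 2 + x ^ 4 / 24 - x ^ 6 / 720 ≤ cos x := by
  have := nonneg_of_hasDerivAt_nonneg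
    (f := fun x => cos x - (1 - x ^ 2 / 2 + x ^ 4 / 24 - x ^ 6 / 720))
    (f' := fun x => x - x ^ 3 / 6 + x ^ 5 / 120 - sin x) (by simp)
    (fun y => ?_) (fun y hy => sub_nonneg.2 (sin_le_taylor_five hy)) hx
  · linarith
  · refine HasDerivAt.congr_deriv ((hasDerivAt_cos y).sub (((((hasDerivAt_pow 2 y).div_const 2).const_sub 1).add
      ((hasDerivAt_pow 4 y).div_const 24)).sub ((hasDerivAt_pow 6 y).div_const 720))) ?_
    push_cast
    ring

lemma taylor_seven_le_sin {x : ℝ} (hx : 0 ≤ x) :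
    x - x ^ 3 / 6 + x ^ 5 / 120 - x ^ 7 / 5040 ≤ sin x := by
  have := nonneg_of_hasDerivAt_nonneg
    (f := fun x => sin x - (x - x ^ 3 / 6 + x ^ 5 / 120 - x ^ 7 / 5040))
    (f' := fun x => cos x - (1 - x ^ 2 / 2 + x ^ 4 / 24 - x ^ 6 / 720)) (by simp)
    (fun y => ?_) (fun y hy => sub_nonneg.2 (taylor_six_le_cos hy)) hx
  · linarith
  · refine HasDerivAt.congr_deriv ((hasDerivAt_sin y).sub ((((hasDerivAt_id y).sub
      ((hasDerivAt_pow 3 y).div_const 6)).add ((hasDerivAt_pow 5 y).div_const 120)).sub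
      ((hasDerivAt_pow 7 y).div_const 5040))) ?_
    push_cast
    ring

lemma cos_le_taylor_eight {x : ℝ} (hx : 0 ≤ x) :
    cos x ≤ 1 - x ^ 2 / 2 + x ^ 4 / 24 - x ^ 6 / 720 + x ^ 8 / 40320 := by
  have := nonneg_of_hasDerivAt_nonneg
    (f := fun x => 1 - x ^ 2 / 2 + x ^ 4 / 24 - x ^ 6 / 720 + x ^ 8 / 40320 - cos x)
    (f' := fun x => sin x - (x - x ^ 3 / 6 + x ^ 5 / 120 - x ^ 7 / 5040)) (by simp)
    (fun y => ?_) (fun y hy => sub_nonneg.2 (taylor_seven_le_sin hy)) hx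
  · linarith
  · refine HasDerivAt.congr_deriv (((((((hasDerivAt_pow 2 y).div_const 2).const_sub 1).add
      ((hasDerivAt_pow 4 y).div_const 24)).sub ((hasDerivAt_pow 6 y).div_const 720)).add
      ((hasDerivAt_pow 8 y).div_const 40320)).sub (hasDerivAt_cos y)) ?_
    push_cast
    ring

lemma sq_lt_of_lt_pi_div_two {t : ℝ} (h0 : 0 < t) (h1 : t < π / 2) : t ^ 2 < 5 / 2 := by
  have := pi_lt_d2
  nlinarith

lemma sq_mul_one_add_cos_lt {t : ℝ} (h0 : 0 < t) (h1 : t < π / 2) :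
    t ^ 2 * (1 + cos t) < sin t ^ 2 + t * sin t := by
  have hw := sq_lt_of_lt_pi_div_two h0 h1
  have hs := taylor_seven_le_sin h0.le
  have hc := cos_le_taylor_four h0.le
  obtain ⟨w, hw'⟩ : ∃ w, w = t ^ 2 := ⟨_, rfl⟩
  have hw0 : 0 < w := by rw [hw']; positivity
  rw [← hw'] at hw
  have hS : t * (1 - w / 6 + w ^ 2 / 120 - w ^ 3 / 5040) ≤ sin t := by
    rw [hw']; linarith
  have hC : cos t ≤ 1 - w / 2 + w ^ 2 / 24 := by rw [hw']; linarith
  set S := 1 - w / 6 + w ^ 2 / 120 - w ^ 3 / 5040 with hSdef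
  have hS0 : 0 < S := by rw [hSdef]; nlinarith [pow_pos hw0 2, mul_pos hw0 hw0]
  have h2 : (t * S) ^ 2 ≤ sin t ^ 2 := pow_le_pow_left₀ (by positivity) hS 2
  have h3 : t * (t * S) ≤ t * sin t := by gcongr
  have h4 : w * (1 + cos t) ≤ w * (2 - w / 2 + w ^ 2 / 24) :=
    mul_le_mul_of_nonneg_left (by linarith) hw0.le
  have h5 : w * (S ^ 2 + S - (2 - w / 2 + w ^ 2 / 24)) =
      w ^ 3 * (1 / 90 - 17 / 5040 * w + 41 / 302400 * w ^ 2 - 1 / 302400 * w ^ 3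
        + 1 / 25401600 * w ^ 4) := by
    rw [hSdef]; ring
  have h6 : 0 < w ^ 3 * (1 / 90 - 17 / 5040 * w + 41 / 302400 * w ^ 2 - 1 / 302400 * w ^ 3
        + 1 / 25401600 * w ^ 4) := by
    have : 0 ≤ w ^ 2 * (5 / 2 - w) := by
      have : 0 ≤ 5 / 2 - w := by linarith
      positivity
    refine mul_pos (by positivity) ?_
    nlinarith [pow_pos hw0 2, pow_pos hw0 4]
  have h7 : w * (S ^ 2 + S) = (t * S) ^ 2 + t * (t * S) := by rw [hw']; ring
  rw [← hw']
  nlinarith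

/-- The lower bound `A + G - P < X` in the variable `t` with `sin t = (a - b) / (a + b)`. -/
lemma one_add_cos_sub_lt_exp {t : ℝ} (h0 : 0 < t) (h1 : t < π / 2) :
    1 + cos t - sin t / t < exp (t * cos t / sin t - 1) := by
  let H : ℝ → ℝ := fun x => cos x / sinc x - 1 - log (1 + cos x - sinc x)
  have hcos : ∀ x ∈ Ico 0 (π / 2), 0 < cos x := fun x hx =>
    cos_pos_of_mem_Ioo ⟨by linarith [hx.1, pi_pos], hx.2⟩
  have hsin : ∀ x ∈ Ioo 0 (π / 2), 0 < sin x := fun x hx =>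
    sin_pos_of_pos_of_lt_pi hx.1 (by linarith [hx.2, pi_pos])
  have hsinc : ∀ x ∈ Ico 0 (π / 2), 0 < sinc x := fun x hx => by
    rcases hx.1.eq_or_lt with rfl | h
    · simp
    · rw [sinc_of_ne_zero h.ne']
      exact div_pos (hsin x ⟨h, hx.2⟩) h
  have hpos : ∀ x ∈ Ico 0 (π / 2), 0 < 1 + cos x - sinc x := fun x hx => by
    linarith [hcos x hx, sinc_le_one x]
  have hcont : ContinuousOn H (Ico 0 (π / 2)) := by
    have hs : ContinuousOn sinc (Ico 0 (π / 2)) := continuous_sinc.continuousOn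
    have hc : ContinuousOn cos (Ico 0 (π / 2)) := continuous_cos.continuousOn
    exact ((hc.div hs fun x hx => (hsinc x hx).ne').sub continuousOn_const).sub
      (((continuousOn_const.add hc).sub hs).log fun x hx => (hpos x hx).ne')
  have hmono : StrictMonoOn H (Ico 0 (π / 2)) := by
    refine strictMonoOn_of_deriv_pos (convex_Ico _ _) hcont fun x hx => ?_
    rw [interior_Ico] at hx
    have hx0 : 0 < x := hx.1
    have hs := hsin x hx
    have hp := hpos x ⟨hx0.le, hx.2⟩
    rw [sinc_of_ne_zero hx0.ne'] at hp
    have hd : HasDerivAt (fun y => y * cos y / sin y - 1 - log (1 + cos y - sin y / y))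
        (((1 * cos x + x * (-sin x)) * sin x - x * cos x * cos x) / sin x ^ 2
          - (-sin x - (cos x * x - sin x * 1) / x ^ 2) / (1 + cos x - sin x / x)) x :=
      (((((hasDerivAt_id x).mul (hasDerivAt_cos x)).div (hasDerivAt_sin x) hs.ne').sub_const 1)).sub
        ((((hasDerivAt_cos x).const_add 1).sub
          ((hasDerivAt_sin x).div (hasDerivAt_id x) hx0.ne')).log hp.ne')
    have heq : H =ᶠ[nhds x] fun y => y * cos y / sin y - 1 - log (1 + cos y - sin y / y) := by
      filter_upwards [isOpen_Ioo.mem_nhds hx] with y hy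
      have hy0 : y ≠ 0 := hy.1.ne'
      have := (hsin y hy).ne'
      simp only [H, sinc_of_ne_zero hy0]
      congr 2
      field_simp
    rw [(hd.congr_of_eventuallyEq heq).deriv]
    have hden : 0 < x * (1 + cos x) - sin x := by
      have := mul_pos hx0 hp
      have e : x * (1 + cos x - sin x / x) = x * (1 + cos x) - sin x := by field_simp
      linarith
    have hkey : ((1 * cos x + x * (-sin x)) * sin x - x * cos x * cos x) / sin x ^ 2
          - (-sin x - (cos x * x - sin x * 1) / x ^ 2) / (1 + cos x - sin x / x)
        = (x - sin x) * (sin x ^ 2 + x * sin x - x ^ 2 * (1 + cos x))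
          / (sin x ^ 2 * (x * (x * (1 + cos x) - sin x))) := by
      have e : 1 + cos x - sin x / x = (x * (1 + cos x) - sin x) / x := by field_simp
      have e1 : (1 * cos x + x * (-sin x)) * sin x - x * cos x * cos x = cos x * sin x - x := by
        linear_combination (-x) * sin_sq_add_cos_sq x
      rw [e, e1]
      field_simp
      have : cos x ^ 2 = 1 - sin x ^ 2 := by linarith [sin_sq_add_cos_sq x]
      ring_nf
      simp only [this]
      ring
    rw [hkey]
    have := sq_mul_one_add_cos_lt hx0 hx.2
    have := sin_lt hx0
    apply div_pos <;> apply mul_pos <;> positivity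
  have hlt : H 0 < H t := hmono ⟨le_rfl, by positivity⟩ ⟨h0.le, h1⟩ h0
  have ht := hsin t ⟨h0, h1⟩
  have hp := hpos t ⟨h0.le, h1⟩
  simp only [H, sinc_of_ne_zero h0.ne'] at hlt
  rw [sinc_of_ne_zero h0.ne'] at hp
  rw [← log_lt_iff_lt_exp hp]
  have e : cos t / (sin t / t) = t * cos t / sin t := by field_simp
  rw [e] at hlt
  norm_num at hlt
  linarith

/-- The upper bound `P + X < A + G + 7 / 100 * (A - G)` in the variable `t` with
`sin t = (a - b) / (a + b)`. -/
lemma sin_div_add_exp_lt {t : ℝ} (h0 : 0 < t) (h1 : t < π / 2) :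
    sin t / t + exp (t * cos t / sin t - 1) < 1 + cos t + 7 / 100 * (1 - cos t) := by
  have hw := sq_lt_of_lt_pi_div_two h0 h1
  have hs := taylor_seven_le_sin h0.le
  have hs' := sin_le_taylor_five h0.le
  have hc := cos_le_taylor_eight h0.le
  have hc' := taylor_six_le_cos h0.le
  have hsin : 0 < sin t := sin_pos_of_pos_of_lt_pi h0 (by linarith [pi_pos])
  obtain ⟨w, hw'⟩ : ∃ w, w = t ^ 2 := ⟨_, rfl⟩
  have hw0 : 0 < w := by rw [hw']; positivity
  rw [← hw'] at hw
  have hS : t * (1 - w / 6 + w ^ 2 / 120 - w ^ 3 / 5040) ≤ sin t := by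
    rw [hw']; linarith
  have hS' : sin t / t ≤ 1 - w / 6 + w ^ 2 / 120 := by
    rw [div_le_iff₀ h0, hw']; linarith
  have hC : cos t ≤ 1 - w / 2 + w ^ 2 / 24 - w ^ 3 / 720 + w ^ 4 / 40320 := by
    rw [hw']; linarith
  have hC' : 1 - w / 2 + w ^ 2 / 24 - w ^ 3 / 720 ≤ cos t := by rw [hw']; linarith
  have hd : 0 ≤ 5 / 2 - w := by linarith
  have hx : t * cos t / sin t - 1 ≤ -(w / 3 + w ^ 2 / 45) := by
    rw [sub_le_iff_le_add, div_le_iff₀ hsin]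
    have hq : 0 ≤ 1 - w / 3 - w ^ 2 / 45 := by nlinarith
    have e : (1 - w / 6 + w ^ 2 / 120 - w ^ 3 / 5040) * (1 - w / 3 - w ^ 2 / 45)
        - (1 - w / 2 + w ^ 2 / 24 - w ^ 3 / 720 + w ^ 4 / 40320)
        = w ^ 3 * (2 / 945 - 29 / 201600 * w + w ^ 2 / 226800) := by ring
    have e' : 0 ≤ w ^ 3 * (2 / 945 - 29 / 201600 * w + w ^ 2 / 226800) :=
      mul_nonneg (by positivity) (by nlinarith)
    have h2 : t * cos t ≤
        t * ((1 - w / 6 + w ^ 2 / 120 - w ^ 3 / 5040) * (1 - w / 3 - w ^ 2 / 45)) := by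
      gcongr; linarith
    have h3 := mul_le_mul_of_nonneg_right hS hq
    linarith
  obtain ⟨x, hxdef⟩ : ∃ x, x = w / 3 + w ^ 2 / 45 := ⟨_, rfl⟩
  rw [← hxdef] at hx
  have hx0 : 0 ≤ x := by rw [hxdef]; positivity
  have hE : 1 + x + x ^ 2 / 2 + x ^ 3 / 6 ≤ exp x := by
    have := sum_le_exp_of_nonneg hx0 4
    simpa [Finset.sum_range_succ, Nat.factorial] using this
  have hexp : exp (t * cos t / sin t - 1) ≤ (1 + x + x ^ 2 / 2 + x ^ 3 / 6)⁻¹ := by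
    refine (exp_le_exp.2 hx).trans ?_
    rw [exp_neg]
    exact inv_anti₀ (by positivity) hE
  have hR : (1 + x + x ^ 2 / 2 + x ^ 3 / 6)⁻¹ <
      1 - w / 3 + w ^ 2 / 30 - w ^ 3 / 720 + 7 / 100 * (w / 2 - w ^ 2 / 24 + w ^ 3 / 720) := by
    rw [inv_lt_iff_one_lt_mul₀ (by positivity), mul_comm, ← sub_pos]
    have e : (1 + x + x ^ 2 / 2 + x ^ 3 / 6) *
      (1 - w / 3 + w ^ 2 / 30 - w ^ 3 / 720 + 7 / 100 * (w / 2 - w ^ 2 / 24 + w ^ 3 / 720)) - 1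
      = w * (7 / 200 + 7 / 800 * w - 503 / 648000 * w ^ 2 - 617 / 972000 * w ^ 3
        - 61 / 1296000 * w ^ 4 + 839 / 174960000 * w ^ 5 + 29 / 656100000 * w ^ 6
        - 133 / 2624400000 * w ^ 7 - 31 / 13122000000 * w ^ 8) := by
      rw [hxdef]; ring
    rw [e]
    have b : ∀ n : ℕ, w ^ n ≤ (5 / 2) ^ n := fun n => pow_le_pow_left₀ hw0.le hw.le n
    have b2 := b 2
    have b3 := b 3
    have b4 := b 4
    have b7 := b 7
    have b8 := b 8
    have p5 : 0 ≤ w ^ 5 := by positivity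
    have p6 : 0 ≤ w ^ 6 := by positivity
    refine mul_pos hw0 ?_
    norm_num at b2 b3 b4 b7 b8
    linarith
  linarith

lemma two_add_mul_sq_le_rpow_add_rpow {δ : ℝ} (hδ0 : 0 ≤ δ) (hδ1 : δ ≤ 1) {y : ℝ} (hy0 : 0 ≤ y)
    (hy1 : y < 1) :
    2 + (1 + δ) * δ * y ^ 2 ≤ (1 + y) ^ (1 + δ) + (1 - y) ^ (1 + δ) := by
  have hder : ∀ p x : ℝ, x ∈ Ico (0 : ℝ) 1 →
      HasDerivAt (fun y : ℝ => (1 + y) ^ p) (p * (1 + x) ^ (p - 1)) x ∧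
      HasDerivAt (fun y : ℝ => (1 - y) ^ p) (-(p * (1 - x) ^ (p - 1))) x := fun p x hx => by
    constructor
    · refine HasDerivAt.congr_deriv (((hasDerivAt_id x).const_add 1).rpow_const (p := p)
        (Or.inl (by simp only [id]; linarith [hx.1]))) ?_
      simp
    · refine HasDerivAt.congr_deriv (((hasDerivAt_id x).const_sub 1).rpow_const (p := p)
        (Or.inl (by simp only [id]; linarith [hx.2]))) ?_
      simp
  have hfirst : ∀ x ∈ Ico (0 : ℝ) 1, 0 ≤ (1 + x) ^ δ - (1 - x) ^ δ - 2 * δ * x := by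
    have hd : ∀ x ∈ Ico (0 : ℝ) 1,
        HasDerivAt (fun x : ℝ => (1 + x) ^ δ - (1 - x) ^ δ - 2 * δ * x)
        (δ * ((1 + x) ^ (δ - 1) + (1 - x) ^ (δ - 1) - 2)) x := fun x hx => by
      refine HasDerivAt.congr_deriv (((hder δ x hx).1.sub (hder δ x hx).2).sub
        ((hasDerivAt_id x).const_mul (2 * δ))) ?_
      ring
    have hmono : MonotoneOn (fun x : ℝ => (1 + x) ^ δ - (1 - x) ^ δ - 2 * δ * x) (Ico 0 1) := by
      refine monotoneOn_of_deriv_nonneg (convex_Ico 0 1)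
        (fun x hx => (hd x hx).continuousAt.continuousWithinAt)
        (fun x hx => (hd x (interior_subset hx)).differentiableAt.differentiableWithinAt)
        fun x hx => ?_
      have hx' := interior_subset hx
      rw [(hd x hx').deriv]
      have h1 : 0 < 1 + x := by linarith [hx'.1]
      have h2 : 0 < 1 - x := by linarith [hx'.2]
      have hprod : 1 ≤ (1 + x) ^ (δ - 1) * (1 - x) ^ (δ - 1) := by
        rw [← mul_rpow h1.le h2.le]
        exact one_le_rpow_of_pos_of_le_one_of_nonpos (mul_pos h1 h2) (by nlinarith [sq_nonneg x])
          (by linarith)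
      have hu : 0 < (1 + x) ^ (δ - 1) := by positivity
      have hv : 0 < (1 - x) ^ (δ - 1) := by positivity
      refine mul_nonneg hδ0 ?_
      nlinarith [sq_nonneg ((1 + x) ^ (δ - 1) - (1 - x) ^ (δ - 1))]
    intro x hx
    simpa using hmono ⟨le_rfl, zero_lt_one⟩ hx hx.1
  have hd : ∀ x ∈ Ico (0 : ℝ) 1,
      HasDerivAt (fun x : ℝ => (1 + x) ^ (1 + δ) + (1 - x) ^ (1 + δ) - (1 + δ) * δ * x ^ 2)
      ((1 + δ) * ((1 + x) ^ δ - (1 - x) ^ δ - 2 * δ * x)) x := fun x hx => by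
    refine HasDerivAt.congr_deriv (((hder (1 + δ) x hx).1.add (hder (1 + δ) x hx).2).sub
      ((hasDerivAt_pow 2 x).const_mul ((1 + δ) * δ))) ?_
    rw [add_sub_cancel_left]
    push_cast
    ring
  have hmono : MonotoneOn
      (fun x : ℝ => (1 + x) ^ (1 + δ) + (1 - x) ^ (1 + δ) - (1 + δ) * δ * x ^ 2) (Ico 0 1) := by
    refine monotoneOn_of_deriv_nonneg (convex_Ico 0 1)
      (fun x hx => (hd x hx).continuousAt.continuousWithinAt)
      (fun x hx => (hd x (interior_subset hx)).differentiableAt.differentiableWithinAt)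
      fun x hx => ?_
    have hx' := interior_subset hx
    rw [(hd x hx').deriv]
    exact mul_nonneg (by linarith) (hfirst x hx')
  have := hmono ⟨le_rfl, zero_lt_one⟩ ⟨hy0, hy1⟩ hy0
  norm_num at this
  linarith

lemma Mp_half {a b : ℝ} (ha : 0 < a) (hb : 0 < b) : Mp (1 / 2) a b = (Am a b + Gm a b) / 2 := by
  rw [Mp, if_neg (by norm_num), Am, Gm, ← sqrt_eq_rpow, ← sqrt_eq_rpow, sqrt_mul ha.le]
  norm_num
  nlinarith [sq_sqrt ha.le, sq_sqrt hb.le]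

/-- A lower bound for power means of exponent between `1 / 2` and `1` by a convex combination of
the arithmetic and the geometric mean. -/
lemma add_mul_sub_le_Mp {a b p : ℝ} (hb : 0 < b) (hab : b ≤ a) (hp0 : 1 / 2 ≤ p) (hp1 : p ≤ 1) :
    (Am a b + Gm a b) / 2 + (2 * p - 1) * ((Am a b - Gm a b) / 2) ≤ Mp p a b := by
  have ha : 0 < a := hb.trans_le hab
  obtain ⟨α, hα, rfl⟩ : ∃ α, 0 < α ∧ a = α ^ 2 := ⟨√a, sqrt_pos.2 ha, (sq_sqrt ha.le).symm⟩
  obtain ⟨β, hβ, rfl⟩ : ∃ β, 0 < β ∧ b = β ^ 2 := ⟨√b, sqrt_pos.2 hb, (sq_sqrt hb.le).symm⟩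
  have hαβ : β ≤ α := (pow_le_pow_iff_left₀ hβ.le hα.le two_ne_zero).1 hab
  have hG : Gm (α ^ 2) (β ^ 2) = α * β := by
    rw [Gm, ← mul_pow, sqrt_sq (by positivity)]
  obtain ⟨m, hm⟩ : ∃ m, m = (α + β) / 2 := ⟨_, rfl⟩
  obtain ⟨y, hy⟩ : ∃ y, y = (α - β) / (α + β) := ⟨_, rfl⟩
  have hm0 : 0 < m := by rw [hm]; positivity
  have hy0 : 0 ≤ y := by rw [hy]; exact div_nonneg (by linarith) (by positivity)
  have hy1 : y < 1 := by rw [hy, div_lt_one (by positivity)]; linarith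
  have hαm : α = m * (1 + y) := by rw [hm, hy]; field_simp; ring
  have hβm : β = m * (1 - y) := by rw [hm, hy]; field_simp; ring
  have hJ := two_add_mul_sq_le_rpow_add_rpow (δ := 2 * p - 1) (by linarith) (by linarith) hy0 hy1
  rw [show 1 + (2 * p - 1) = 2 * p by ring] at hJ
  have hpow : ∀ x : ℝ, 0 < x → (x ^ 2) ^ p = x ^ (2 * p) := fun x hx => by
    rw [← rpow_natCast, ← rpow_mul hx.le]; norm_num
  have hmean : m ^ (2 * p) * (1 + p * ((2 * p - 1) * y ^ 2)) ≤
      ((α ^ 2) ^ p + (β ^ 2) ^ p) / 2 := by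
    rw [hpow α hα, hpow β hβ, hαm, hβm, mul_rpow hm0.le (by linarith),
      mul_rpow hm0.le (by linarith)]
    have := mul_le_mul_of_nonneg_left hJ (rpow_nonneg hm0.le (2 * p))
    linarith
  have hz : 0 ≤ (2 * p - 1) * y ^ 2 := mul_nonneg (by linarith) (sq_nonneg y)
  have hp : 0 < p := by linarith
  have hbern : 1 + (2 * p - 1) * y ^ 2 ≤ (1 + p * ((2 * p - 1) * y ^ 2)) ^ (1 / p) := by
    have := one_add_mul_self_le_rpow_one_add (s := p * ((2 * p - 1) * y ^ 2))
      (by linarith [mul_nonneg hp.le hz]) (p := 1 / p) (by rw [le_div_iff₀ hp]; linarith)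
    rwa [← mul_assoc, one_div_mul_cancel hp.ne', one_mul] at this
  rw [Mp, if_neg hp.ne', hG, Am]
  calc (((α ^ 2 + β ^ 2) / 2 + α * β) / 2 + (2 * p - 1) * (((α ^ 2 + β ^ 2) / 2 - α * β) / 2))
      = m ^ 2 * (1 + (2 * p - 1) * y ^ 2) := by rw [hαm, hβm]; ring
    _ ≤ m ^ 2 * (1 + p * ((2 * p - 1) * y ^ 2)) ^ (1 / p) := by gcongr
    _ = (m ^ (2 * p) * (1 + p * ((2 * p - 1) * y ^ 2))) ^ (1 / p) := by
      rw [mul_rpow (by positivity) (by positivity), ← rpow_mul hm0.le,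
        show 2 * p * (1 / p) = ((2 : ℕ) : ℝ) by field_simp; norm_num, rpow_natCast]
    _ ≤ _ := by gcongr

lemma Mp_comm (p a b : ℝ) : Mp p a b = Mp p b a := by
  simp only [Mp, add_comm, mul_comm]

/-- The angle `t = arcsin ((a - b) / (a + b))` parametrizes the means of `a` and `b`. -/
lemma exists_angle {a b : ℝ} (hb : 0 < b) (hab : b < a) :
    ∃ t, 0 < t ∧ t < π / 2 ∧ Gm a b = Am a b * cos t ∧ Pm a b = Am a b * (sin t / t) ∧
      Xm a b = Am a b * exp (t * cos t / sin t - 1) := by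
  have ha : 0 < a := hb.trans hab
  have hs0 : 0 < (a - b) / (a + b) := div_pos (by linarith) (by linarith)
  have hs1 : (a - b) / (a + b) < 1 := by rw [div_lt_one (by positivity)]; linarith
  have ht0 := arcsin_pos.2 hs0
  have ht1 := arcsin_lt_pi_div_two.2 hs1
  have hsin : sin (arcsin ((a - b) / (a + b))) = (a - b) / (a + b) :=
    sin_arcsin (by linarith) hs1.le
  have hcos : cos (arcsin ((a - b) / (a + b))) = √(a * b) / ((a + b) / 2) := by
    rw [cos_arcsin, show 1 - ((a - b) / (a + b)) ^ 2 = a * b / ((a + b) / 2) ^ 2 by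
      field_simp; ring, sqrt_div' _ (by positivity), sqrt_sq (by positivity)]
  have hG : Gm a b = Am a b * cos (arcsin ((a - b) / (a + b))) := by
    rw [hcos, Gm, Am]; field_simp
  have hP : Pm a b = Am a b *
      (sin (arcsin ((a - b) / (a + b))) / arcsin ((a - b) / (a + b))) := by
    rw [hsin, Pm, Am]
    generalize arcsin ((a - b) / (a + b)) = t at ht0
    field_simp
  refine ⟨_, ht0, ht1, hG, hP, ?_⟩
  have hA : 0 < Am a b := by rw [Am]; positivity
  rw [Xm, hG, hP]
  have hs : 0 < sin (arcsin ((a - b) / (a + b))) := by rwa [hsin]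
  generalize arcsin ((a - b) / (a + b)) = t at ht0 hs
  congr 3
  field_simp

lemma mean_bounds_of_lt {a b k : ℝ} (hb : 0 < b) (hab : b < a) (hk0 : 107 / 200 ≤ k)
    (hk1 : k ≤ 1) :
    Mp (1 / 2) a b < (Pm a b + Xm a b) / 2 ∧ (Pm a b + Xm a b) / 2 < Mp k a b := by
  have ha : 0 < a := hb.trans hab
  obtain ⟨t, h0, h1, hG, hP, hX⟩ := exists_angle hb hab
  have hA : 0 < Am a b := by rw [Am]; positivity
  have hlow := mul_lt_mul_of_pos_left (one_add_cos_sub_lt_exp h0 h1) hA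
  have hupp := mul_lt_mul_of_pos_left (sin_div_add_exp_lt h0 h1) hA
  constructor
  · rw [Mp_half ha hb, hX, hP, hG]
    linarith
  · refine lt_of_lt_of_le ?_ (add_mul_sub_le_Mp hb hab.le (by linarith) hk1)
    have hAG : 0 ≤ Am a b * (1 - cos t) := mul_nonneg hA.le (by linarith [cos_le_one t])
    have hk : 0 ≤ (2 * k - 1 - 7 / 100) * (Am a b * (1 - cos t)) :=
      mul_nonneg (by linarith) hAG
    rw [hX, hP, hG]
    linarith

theorem stmt_5 (a b : ℝ) (ha : 0 < a) (hb : 0 < b) (hab : a ≠ b) :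
    Mp (1 / 2) a b < (Pm a b + Xm a b) / 2 ∧
    (Pm a b + Xm a b) / 2 < Mp ((5 * Real.log 2 + 2) / (6 * (Real.log 2 + 1))) a b := by
  have hl := log_two_gt_d9
  have hl' := log_two_lt_d9
  have hk0 : 107 / 200 ≤ (5 * Real.log 2 + 2) / (6 * (Real.log 2 + 1)) := by
    rw [le_div_iff₀ (by linarith)]; linarith
  have hk1 : (5 * Real.log 2 + 2) / (6 * (Real.log 2 + 1)) ≤ 1 := by
    rw [div_le_one (by linarith)]; linarith
  rcases hab.lt_or_gt with h | h
  · rw [Pm_comm, Xm_comm, Mp_comm, Mp_comm _ a b]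
    exact mean_bounds_of_lt ha h hk0 hk1
  · exact mean_bounds_of_lt hb h hk0 hk1
end

section
/- The function h(x) = log(x/sin x) / log(e^{1 − x/tan x}·sin x / x) is strictly decreasing on (0, π/2), with limit 1 as x → 0⁺ and limit β₂ = log(π/2)/log(2e/π) as x → π/2⁻; in particular its range on (0, π/2) is the interval (β₂, 1). -/
open Real

/-- β₂ = log(π/2)/log(2e/π) -/
noncomputable def β₂ : ℝ := Real.log (π / 2) / Real.log (2 * Real.exp 1 / π)

/-- h(x) = log(x/sin x) / log(e^{1 − x/tan x}·sin x / x) -/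
noncomputable def h (x : ℝ) : ℝ :=
  Real.log (x / Real.sin x) / Real.log (Real.exp (1 - x / Real.tan x) * Real.sin x / x)

open Filter Set Topology

/-- A monotone form of l'Hôpital's rule: if `f' = r * g'` with `g' > 0` and `r` strictly increasing,
and `f`, `g` vanish at `0⁺`, then `f / g` is strictly increasing and has the same limit as `r`. -/
theorem strictMonoOn_div_of_hasDerivAt {b L : ℝ} (hb : 0 < b) {f f' g g' r : ℝ → ℝ}
    (hf : ∀ x ∈ Ioo 0 b, HasDerivAt f (f' x) x) (hg : ∀ x ∈ Ioo 0 b, HasDerivAt g (g' x) x)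
    (hf0 : Tendsto f (𝓝[>] 0) (𝓝 0)) (hg0 : Tendsto g (𝓝[>] 0) (𝓝 0))
    (hpos : ∀ x ∈ Ioo 0 b, 0 < g' x) (hr : ∀ x ∈ Ioo 0 b, f' x = r x * g' x)
    (hmono : StrictMonoOn r (Ioo 0 b)) (hL : Tendsto r (𝓝[>] 0) (𝓝 L)) :
    (∀ x ∈ Ioo 0 b, 0 < g x) ∧ StrictMonoOn (fun x => f x / g x) (Ioo 0 b) ∧
      Tendsto (fun x => f x / g x) (𝓝[>] 0) (𝓝 L) := by
  have hfl : ∀ x ∈ Ioo 0 b, ∀ s, Tendsto f (𝓝[s] x) (𝓝 (f x)) := fun x hx s =>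
    (hf x hx).continuousAt.continuousWithinAt
  have hgl : ∀ x ∈ Ioo 0 b, ∀ s, Tendsto g (𝓝[s] x) (𝓝 (g x)) := fun x hx s =>
    (hg x hx).continuousAt.continuousWithinAt
  have hgmono : StrictMonoOn g (Ioo 0 b) := by
    refine strictMonoOn_of_deriv_pos (convex_Ioo 0 b)
      (fun x hx => (hg x hx).continuousAt.continuousWithinAt) fun x hx => ?_
    rw [interior_Ioo] at hx
    rw [(hg x hx).deriv]
    exact hpos x hx
  have hgpos : ∀ x ∈ Ioo 0 b, 0 < g x := by
    intro x hx
    have hy : x / 2 ∈ Ioo 0 b := ⟨by linarith [hx.1], by linarith [hx.1, hx.2]⟩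
    refine lt_of_le_of_lt ?_ (hgmono hy hx (by linarith [hx.1]))
    refine le_of_tendsto hg0 ?_
    filter_upwards [Ioo_mem_nhdsGT hy.1] with t ht
    exact (hgmono ⟨ht.1, ht.2.trans hy.2⟩ hy ht.2).le
  refine ⟨hgpos, ?_, ?_⟩
  · intro x hx y hy hxy
    obtain ⟨c, hc, hc'⟩ := exists_ratio_hasDerivAt_eq_ratio_slope' (a := 0) (b := x) f f' hx.1 g g'
      (fun t ht => hf t ⟨ht.1, ht.2.trans hx.2⟩) (fun t ht => hg t ⟨ht.1, ht.2.trans hx.2⟩)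
      hf0 hg0 (hfl x hx _) (hgl x hx _)
    obtain ⟨d, hd, hd'⟩ := exists_ratio_hasDerivAt_eq_ratio_slope' (a := x) (b := y) f f' hxy g g'
      (fun t ht => hf t ⟨hx.1.trans ht.1, ht.2.trans hy.2⟩)
      (fun t ht => hg t ⟨hx.1.trans ht.1, ht.2.trans hy.2⟩)
      (hfl x hx _) (hgl x hx _) (hfl y hy _) (hgl y hy _)
    have hcm : c ∈ Ioo 0 b := ⟨hc.1, hc.2.trans hx.2⟩
    have hdm : d ∈ Ioo 0 b := ⟨hx.1.trans hd.1, hd.2.trans hy.2⟩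
    have hfx : f x = r c * g x := by
      rw [hr c hcm] at hc'
      exact mul_right_cancel₀ (hpos c hcm).ne' (by linear_combination -hc')
    have hfy : f y - f x = r d * (g y - g x) := by
      rw [hr d hdm] at hd'
      exact mul_right_cancel₀ (hpos d hdm).ne' (by linear_combination -hd')
    have hcd : r c < r d := hmono hcm hdm (hc.2.trans hd.1)
    have hgxy := hgmono hx hy hxy
    have hgx := hgpos x hx
    change f x / g x < f y / g y
    rw [lt_div_iff₀ (hgpos y hy), hfx, mul_div_cancel_right₀ _ hgx.ne']
    nlinarith [mul_pos (sub_pos.2 hcd) (sub_pos.2 hgxy)]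
  · refine HasDerivAt.lhopital_zero_right_on_Ioo hb hf hg (fun x hx => (hpos x hx).ne') hf0 hg0 ?_
    refine hL.congr' ?_
    filter_upwards [Ioo_mem_nhdsGT hb] with x hx
    rw [hr x hx, mul_div_cancel_right₀ _ (hpos x hx).ne']

theorem StrictMonoOn.lt_of_tendsto_nhdsGT {a b L : ℝ} {f : ℝ → ℝ} (hf : StrictMonoOn f (Ioo a b))
    (hL : Tendsto f (𝓝[>] a) (𝓝 L)) {x : ℝ} (hx : x ∈ Ioo a b) : L < f x := by
  obtain ⟨y, hay, hyx⟩ := exists_between hx.1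
  have hy : y ∈ Ioo a b := ⟨hay, hyx.trans hx.2⟩
  refine lt_of_le_of_lt (le_of_tendsto hL ?_) (hf hy hx hyx)
  filter_upwards [Ioo_mem_nhdsGT hay] with t ht
  exact (hf ⟨ht.1, ht.2.trans hy.2⟩ hy ht.2).le

theorem StrictMonoOn.lt_of_tendsto_nhdsLT {a b L : ℝ} {f : ℝ → ℝ} (hf : StrictMonoOn f (Ioo a b))
    (hL : Tendsto f (𝓝[<] b) (𝓝 L)) {x : ℝ} (hx : x ∈ Ioo a b) : f x < L := by
  obtain ⟨y, hxy, hyb⟩ := exists_between hx.2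
  have hy : y ∈ Ioo a b := ⟨hx.1.trans hxy, hyb⟩
  refine lt_of_lt_of_le (hf hx hy hxy) (ge_of_tendsto hL ?_)
  filter_upwards [Ioo_mem_nhdsLT hyb] with t ht
  exact (hf hy ⟨hy.1.trans ht.1, ht.2⟩ ht.1).le

theorem sin_pos_cos_pos {x : ℝ} (hx : x ∈ Ioo 0 (π / 2)) : 0 < sin x ∧ 0 < cos x :=
  ⟨sin_pos_of_pos_of_lt_pi hx.1 (by linarith [hx.2, pi_pos]),
    cos_pos_of_mem_Ioo ⟨by linarith [hx.1, pi_pos], hx.2⟩⟩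

theorem Continuous.tendsto_nhdsGT_zero {f : ℝ → ℝ} (hf : Continuous f) {L : ℝ} (h0 : f 0 = L) :
    Tendsto f (𝓝[>] 0) (𝓝 L) :=
  h0 ▸ hf.continuousAt.continuousWithinAt

theorem tan_div_self_strictMonoOn :
    StrictMonoOn (fun x => tan x / x) (Ioo 0 (π / 2)) ∧
      Tendsto (fun x => tan x / x) (𝓝[>] 0) (𝓝 1) := by
  refine (strictMonoOn_div_of_hasDerivAt (f := tan) (g := fun x => x)
    (f' := fun x => 1 / cos x ^ 2) (g' := fun _ => 1) (r := fun x => 1 / cos x ^ 2)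
    pi_div_two_pos (fun x hx => hasDerivAt_tan (sin_pos_cos_pos hx).2.ne')
    (fun x _ => hasDerivAt_id x) ?_ (continuous_id.tendsto_nhdsGT_zero rfl) (fun _ _ => one_pos)
    (fun _ _ => (mul_one _).symm) ?_ ?_).2
  · have : ContinuousAt tan 0 := continuousAt_tan.2 (by simp)
    simpa using this.tendsto.mono_left nhdsWithin_le_nhds
  · intro x hx y hy hxy
    have hc : cos y < cos x := cos_lt_cos_of_nonneg_of_le_pi_div_two hx.1.le hy.2.le hxy
    have hcy := (sin_pos_cos_pos hy).2
    change 1 / cos x ^ 2 < 1 / cos y ^ 2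
    gcongr
  · have : ContinuousAt (fun x => 1 / cos x ^ 2) 0 := by
      refine ContinuousAt.div (by fun_prop) (by fun_prop) (by simp)
    simpa using this.tendsto.mono_left nhdsWithin_le_nhds

theorem strictMonoOn_sub_sin_mul_cos_div :
    (∀ x ∈ Ioo 0 (π / 2), 0 < sin x * cos x - x * (cos x ^ 2 - sin x ^ 2)) ∧
      StrictMonoOn (fun x => 2 * (x - sin x * cos x) /
        (sin x * cos x - x * (cos x ^ 2 - sin x ^ 2))) (Ioo 0 (π / 2)) ∧
      Tendsto (fun x => 2 * (x - sin x * cos x) /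
        (sin x * cos x - x * (cos x ^ 2 - sin x ^ 2))) (𝓝[>] 0) (𝓝 1) := by
  refine strictMonoOn_div_of_hasDerivAt (f' := fun x => 4 * sin x ^ 2)
    (g' := fun x => 4 * (x * sin x * cos x)) pi_div_two_pos ?_ ?_
    (Continuous.tendsto_nhdsGT_zero (by fun_prop) (by simp))
    (Continuous.tendsto_nhdsGT_zero (by fun_prop) (by simp)) ?_ ?_
    tan_div_self_strictMonoOn.1 tan_div_self_strictMonoOn.2
  · intro x _
    refine (((hasDerivAt_id x).sub
      ((hasDerivAt_sin x).mul (hasDerivAt_cos x))).const_mul 2).congr_deriv ?_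
    linear_combination -2 * sin_sq_add_cos_sq x
  · intro x _
    refine (((hasDerivAt_sin x).mul (hasDerivAt_cos x)).sub ((hasDerivAt_id x).mul
      (((hasDerivAt_cos x).pow 2).sub ((hasDerivAt_sin x).pow 2)))).congr_deriv ?_
    simp
    ring
  · intro x hx
    have := mul_pos (mul_pos hx.1 (sin_pos_cos_pos hx).1) (sin_pos_cos_pos hx).2
    linarith
  · intro x hx
    have := (sin_pos_cos_pos hx).2.ne'
    have := hx.1.ne'
    rw [tan_eq_sin_div_cos]
    field_simp

theorem strictMonoOn_sq_sub_sin_sq_div :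
    (∀ x ∈ Ioo 0 (π / 2), 0 < sin x ^ 2 - x * (sin x * cos x)) ∧
      StrictMonoOn (fun x => (x ^ 2 - sin x ^ 2) / (sin x ^ 2 - x * (sin x * cos x)))
        (Ioo 0 (π / 2)) ∧
      Tendsto (fun x => (x ^ 2 - sin x ^ 2) / (sin x ^ 2 - x * (sin x * cos x)))
        (𝓝[>] 0) (𝓝 1) := by
  obtain ⟨hpos, hmono, hlim⟩ := strictMonoOn_sub_sin_mul_cos_div
  refine strictMonoOn_div_of_hasDerivAt (f' := fun x => 2 * (x - sin x * cos x)) pi_div_two_pos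
    ?_ ?_ (Continuous.tendsto_nhdsGT_zero (by fun_prop) (by simp))
    (Continuous.tendsto_nhdsGT_zero (by fun_prop) (by simp)) hpos ?_ hmono hlim
  · intro x _
    refine (((hasDerivAt_id x).pow 2).sub ((hasDerivAt_sin x).pow 2)).congr_deriv ?_
    simp
    ring
  · intro x _
    refine (((hasDerivAt_sin x).pow 2).sub ((hasDerivAt_id x).mul
      ((hasDerivAt_sin x).mul (hasDerivAt_cos x)))).congr_deriv ?_
    simp
    ring
  · intro x hx
    exact (div_mul_cancel₀ _ (hpos x hx).ne').symm

theorem tendsto_self_div_sin : Tendsto (fun x => x / sin x) (𝓝[>] 0) (𝓝 1) := by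
  have h1 : Tendsto (fun x => (sinc x)⁻¹) (𝓝[>] 0) (𝓝 1) := by
    have := (continuous_sinc.tendsto 0).inv₀ (by simp)
    simpa using this.mono_left nhdsWithin_le_nhds
  refine h1.congr' ?_
  filter_upwards [self_mem_nhdsWithin] with x hx
  rw [sinc_of_ne_zero (ne_of_gt hx), inv_div]

/-- The logarithm in the denominator of `h`, expanded. -/
noncomputable def logDenom (x : ℝ) : ℝ := 1 - x * cos x / sin x - log (x / sin x)

theorem h_eq {x : ℝ} (hx : 0 < x) (hs : 0 < sin x) : h x = log (x / sin x) / logDenom x := by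
  have hx0 := hx.ne'
  have hs0 := hs.ne'
  have : rexp (1 - x / tan x) * sin x / x = rexp (1 - x * cos x / sin x) / (x / sin x) := by
    rw [tan_eq_sin_div_cos, div_div_eq_mul_div]
    field_simp
  rw [h, logDenom, this, log_div (exp_pos _).ne' (div_pos hx hs).ne', log_exp]

theorem log_self_div_sin_pos {x : ℝ} (hx : x ∈ Ioo 0 (π / 2)) : 0 < log (x / sin x) := by
  refine log_pos ?_
  rw [one_lt_div (sin_pos_cos_pos hx).1]
  exact sin_lt hx.1

theorem strictMonoOn_logDenom_div_log :
    StrictMonoOn (fun x => logDenom x / log (x / sin x)) (Ioo 0 (π / 2)) ∧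
      Tendsto (fun x => logDenom x / log (x / sin x)) (𝓝[>] 0) (𝓝 1) := by
  obtain ⟨hpos, hmono, hlim⟩ := strictMonoOn_sq_sub_sin_sq_div
  have hlog : Tendsto (fun x => log (x / sin x)) (𝓝[>] 0) (𝓝 0) := by
    simpa using tendsto_self_div_sin.log one_ne_zero
  have hderiv : ∀ x ∈ Ioo 0 (π / 2), HasDerivAt (fun x => log (x / sin x))
      ((sin x ^ 2 - x * (sin x * cos x)) / (x * sin x ^ 2)) x := by
    intro x hx
    have hs := (sin_pos_cos_pos hx).1.ne'
    have hx0 := hx.1.ne'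
    refine (((hasDerivAt_id x).div (hasDerivAt_sin x) hs).log
      (div_ne_zero hx0 hs)).congr_deriv ?_
    simp
    field_simp
  refine (strictMonoOn_div_of_hasDerivAt
    (f' := fun x => (x ^ 2 - sin x ^ 2) / (x * sin x ^ 2)) pi_div_two_pos ?_ hderiv
    ?_ hlog ?_ ?_ hmono hlim).2
  · intro x hx
    have hs := (sin_pos_cos_pos hx).1.ne'
    have hx0 := hx.1.ne'
    refine (((((hasDerivAt_id x).mul (hasDerivAt_cos x)).div (hasDerivAt_sin x) hs).const_sub
      1).sub (hderiv x hx)).congr_deriv ?_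
    simp
    field_simp
    linear_combination x ^ 2 * sin_sq_add_cos_sq x
  · have hc : Tendsto cos (𝓝[>] 0) (𝓝 1) := continuous_cos.tendsto_nhdsGT_zero cos_zero
    have := ((tendsto_self_div_sin.mul hc).const_sub 1).sub hlog
    simp only [mul_one, sub_self] at this
    refine this.congr fun x => ?_
    rw [logDenom]
    ring
  · intro x hx
    have hs := (sin_pos_cos_pos hx).1
    exact div_pos (hpos x hx) (mul_pos hx.1 (pow_pos hs 2))
  · intro x hx
    have := (hpos x hx).ne'
    rw [div_mul_div_cancel₀ this]

theorem h_eq_inv {x : ℝ} (hx : x ∈ Ioo 0 (π / 2)) : h x = (logDenom x / log (x / sin x))⁻¹ := by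
  rw [h_eq hx.1 (sin_pos_cos_pos hx).1, inv_div]

theorem one_lt_logDenom_div_log {x : ℝ} (hx : x ∈ Ioo 0 (π / 2)) :
    1 < logDenom x / log (x / sin x) :=
  strictMonoOn_logDenom_div_log.1.lt_of_tendsto_nhdsGT strictMonoOn_logDenom_div_log.2 hx

theorem h_strictAntiOn : StrictAntiOn h (Ioo 0 (π / 2)) := by
  intro x hx y hy hxy
  rw [h_eq_inv hx, h_eq_inv hy]
  exact inv_strictAnti₀ (one_pos.trans (one_lt_logDenom_div_log hx))
    (strictMonoOn_logDenom_div_log.1 hx hy hxy)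

theorem h_tendsto_zero : Tendsto h (𝓝[>] 0) (𝓝 1) := by
  have := strictMonoOn_logDenom_div_log.2.inv₀ one_ne_zero
  rw [inv_one] at this
  refine this.congr' ?_
  filter_upwards [Ioo_mem_nhdsGT pi_div_two_pos] with x hx
  exact (h_eq_inv hx).symm

theorem h_continuousAt {x : ℝ} (hx : 0 < x) (hs : 0 < sin x) (hd : logDenom x ≠ 0) :
    ContinuousAt h x := by
  have hq : ContinuousAt (fun x => x / sin x) x :=
    continuousAt_id.div continuous_sin.continuousAt hs.ne'
  have hl : ContinuousAt (fun x => log (x / sin x)) x := hq.log (div_pos hx hs).ne'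
  have hD : ContinuousAt logDenom x := by
    have : ContinuousAt (fun x => x * cos x / sin x) x :=
      ContinuousAt.div (by fun_prop) continuous_sin.continuousAt hs.ne'
    exact (continuousAt_const.sub this).sub hl
  refine (hl.div hD hd).congr ?_
  filter_upwards [lt_mem_nhds hx, continuous_sin.continuousAt.eventually (lt_mem_nhds hs)]
    with y hy hys
  exact (h_eq hy hys).symm

theorem h_continuousOn : ContinuousOn h (Ioo 0 (π / 2)) := by
  intro x hx
  refine (h_continuousAt hx.1 (sin_pos_cos_pos hx).1 fun h0 => ?_).continuousWithinAt
  have := one_lt_logDenom_div_log hx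
  rw [h0, zero_div] at this
  linarith

theorem h_tendsto_pi_div_two : Tendsto h (𝓝[<] (π / 2)) (𝓝 β₂) := by
  have hs : sin (π / 2) = 1 := sin_pi_div_two
  have hval : logDenom (π / 2) = log (2 * rexp 1 / π) := by
    have : 2 * rexp 1 / π = rexp 1 / (π / 2) := by
      field_simp
    rw [this, log_div (exp_pos 1).ne' pi_div_two_pos.ne', log_exp, logDenom]
    simp
  have hpos : 0 < log (2 * rexp 1 / π) := by
    refine log_pos ?_
    rw [one_lt_div pi_pos]
    linarith [pi_lt_d2, exp_one_gt_d9]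
  have hβ : h (π / 2) = β₂ := by
    rw [h_eq pi_div_two_pos (hs ▸ one_pos), hval, hs, div_one, β₂]
  rw [← hβ]
  exact (h_continuousAt pi_div_two_pos (hs ▸ one_pos)
    (hval ▸ hpos.ne')).continuousWithinAt

theorem stmt_9 :
    StrictAntiOn h (Set.Ioo 0 (π / 2)) ∧
    Filter.Tendsto h (nhdsWithin 0 (Set.Ioi 0)) (nhds 1) ∧
    Filter.Tendsto h (nhdsWithin (π / 2) (Set.Iio (π / 2))) (nhds β₂) ∧
    h '' Set.Ioo 0 (π / 2) = Set.Ioo β₂ 1 := by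
  refine ⟨h_strictAntiOn, h_tendsto_zero, h_tendsto_pi_div_two, Subset.antisymm ?_ ?_⟩
  · rintro _ ⟨x, hx, rfl⟩
    have hneg : StrictMonoOn (fun x => -h x) (Ioo 0 (π / 2)) := h_strictAntiOn.neg
    have h0 := hneg.lt_of_tendsto_nhdsGT h_tendsto_zero.neg hx
    have h1 := hneg.lt_of_tendsto_nhdsLT h_tendsto_pi_div_two.neg hx
    exact ⟨neg_lt_neg_iff.1 h1, neg_lt_neg_iff.1 h0⟩
  · exact isPreconnected_Ioo.intermediate_value_Ioo
      (le_principal_iff.2 (Ioo_mem_nhdsLT pi_div_two_pos))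
      (le_principal_iff.2 (Ioo_mem_nhdsGT pi_div_two_pos))
      h_continuousOn h_tendsto_pi_div_two h_tendsto_zero
end

section
/- For every x ∈ (0, π/2), one has (e^{1 − x/tan x}·sin x / x)^{β₂} < x/sin x < e^{1 − x/tan x}·sin x / x, where β₂ = log(π/2)/log(2e/π). -/
open Real

/-- If `F 0 = 0` and `F'` changes sign on `(0, b)` at most once, from positive to negative,
then the same holds for `F` on `(0, b]`. -/
theorem pos_of_nonneg_of_hasDerivAt {F G : ℝ → ℝ} {b : ℝ} (hc : ContinuousOn F (Set.Icc 0 b))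
    (h0 : F 0 = 0) (hd : ∀ x ∈ Set.Ioo 0 b, HasDerivAt F (G x) x)
    (hG : ∀ x y, 0 < x → x < y → y < b → 0 ≤ G y → 0 < G x)
    {x y : ℝ} (hx : 0 < x) (hxy : x < y) (hyb : y ≤ b) (hy : 0 ≤ F y) : 0 < F x := by
  by_contra! hFx
  obtain ⟨ξ, hξ, hξ'⟩ := exists_hasDerivAt_eq_slope F G hxy
    (hc.mono (Set.Icc_subset_Icc hx.le hyb))
    (fun z hz => hd z ⟨hx.trans hz.1, hz.2.trans_le hyb⟩)
  obtain ⟨η, hη, hη'⟩ := exists_hasDerivAt_eq_slope F G hx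
    (hc.mono (Set.Icc_subset_Icc le_rfl (hxy.le.trans hyb)))
    (fun z hz => hd z ⟨hz.1, (hz.2.trans hxy).trans_le hyb⟩)
  have h1 : 0 ≤ G ξ := by
    rw [hξ']
    exact div_nonneg (by linarith) (by linarith)
  have h2 := hG η ξ hη.1 (hη.2.trans hξ.1) (hξ.2.trans_le hyb) h1
  rw [hη', h0] at h2
  have h3 : (F x - 0) / (x - 0) ≤ 0 := div_nonpos_of_nonpos_of_nonneg (by linarith) (by linarith)
  linarith

/-- If `F 0 = 0` and `F' < 0` on `(0, b)`, then `F < 0` on `(0, b)`. -/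
theorem neg_of_hasDerivAt_neg {F G : ℝ → ℝ} {b : ℝ} (hc : ContinuousOn F (Set.Icc 0 b))
    (h0 : F 0 = 0) (hd : ∀ x ∈ Set.Ioo 0 b, HasDerivAt F (G x) x)
    (hG : ∀ x ∈ Set.Ioo 0 b, G x < 0) : ∀ x ∈ Set.Ioo 0 b, F x < 0 := by
  intro x hx
  obtain ⟨η, hη, hη'⟩ := exists_hasDerivAt_eq_slope F G hx.1
    (hc.mono (Set.Icc_subset_Icc le_rfl hx.2.le))
    (fun z hz => hd z ⟨hz.1, hz.2.trans hx.2⟩)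
  have h2 := hG η ⟨hη.1, hη.2.trans hx.2⟩
  rw [hη', h0, sub_zero, sub_zero] at h2
  exact lt_of_not_ge fun h => h2.not_ge (div_nonneg h hx.1.le)

theorem sinc_pos_of_mem_Icc {x : ℝ} (hx : x ∈ Set.Icc 0 (π / 2)) : 0 < sinc x := by
  rcases hx.1.eq_or_lt with rfl | h
  · simp
  · rw [sinc_of_ne_zero h.ne']
    exact div_pos (sin_pos_of_pos_of_lt_pi h (by linarith [hx.2, pi_pos])) h

/-- The function `log (x / sin x) - c * (1 - x / tan x)`, extended continuously to `0`. -/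
noncomputable def logSincGap (c x : ℝ) : ℝ := -log (sinc x) - c * (1 - cos x / sinc x)

/-- The derivative of `logSincGap c`, multiplied by `x * sin x ^ 2`. -/
noncomputable def gapDeriv (c x : ℝ) : ℝ :=
  sin x ^ 2 - (1 - c) * (x * (sin x * cos x)) - c * x ^ 2

/-- The derivative of `gapDeriv c`. -/
noncomputable def gapDeriv' (c x : ℝ) : ℝ :=
  (1 + c) * (sin x * cos x) - (1 - c) * (x * (cos x ^ 2 - sin x ^ 2)) - 2 * c * x

/-- The derivative of `gapDeriv' c`, divided by `4 * sin x`. -/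
noncomputable def gapDeriv'' (c x : ℝ) : ℝ := (1 - c) * (x * cos x) - c * sin x

theorem hasDerivAt_gapDeriv'' (c x : ℝ) :
    HasDerivAt (gapDeriv'' c) ((1 - 2 * c) * cos x - (1 - c) * (x * sin x)) x := by
  have h := (((hasDerivAt_id x).mul (hasDerivAt_cos x)).const_mul (1 - c)).sub
    ((hasDerivAt_sin x).const_mul c)
  refine h.congr_deriv ?_
  simp only [id]
  ring

theorem hasDerivAt_gapDeriv' (c x : ℝ) :
    HasDerivAt (gapDeriv' c) (4 * sin x * gapDeriv'' c x) x := by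
  have h := ((((hasDerivAt_sin x).mul (hasDerivAt_cos x)).const_mul (1 + c)).sub
    (((hasDerivAt_id x).mul (((hasDerivAt_cos x).pow 2).sub
      ((hasDerivAt_sin x).pow 2))).const_mul (1 - c))).sub
    ((hasDerivAt_id x).const_mul (2 * c))
  refine h.congr_deriv ?_
  simp only [id, gapDeriv'', Pi.sub_apply, Pi.pow_apply]
  push_cast
  linear_combination (2 * c) * sin_sq_add_cos_sq x

theorem hasDerivAt_gapDeriv (c x : ℝ) : HasDerivAt (gapDeriv c) (gapDeriv' c x) x := by
  have h := (((hasDerivAt_sin x).pow 2).sub (((hasDerivAt_id x).mul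
    ((hasDerivAt_sin x).mul (hasDerivAt_cos x))).const_mul (1 - c))).sub
    (((hasDerivAt_id x).pow 2).const_mul c)
  refine h.congr_deriv ?_
  simp only [id, gapDeriv', Pi.mul_apply]
  push_cast
  ring

theorem hasDerivAt_logSincGap (c : ℝ) {x : ℝ} (hx : x ∈ Set.Ioo 0 (π / 2)) :
    HasDerivAt (logSincGap c) (gapDeriv c x / (x * sin x ^ 2)) x := by
  have hx0 : x ≠ 0 := hx.1.ne'
  have hs : sin x ≠ 0 := (sin_pos_of_pos_of_lt_pi hx.1 (by linarith [hx.2, pi_pos])).ne'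
  have hq : sin x / x ≠ 0 := div_ne_zero hs hx0
  have h1 := (hasDerivAt_sin x).div (hasDerivAt_id x) hx0
  have h := (h1.log hq).neg.sub
    (((hasDerivAt_const x (1 : ℝ)).sub ((hasDerivAt_cos x).div h1 hq)).const_mul c)
  refine (h.congr_of_eventuallyEq ?_).congr_deriv ?_
  · filter_upwards [isOpen_ne.mem_nhds hx0] with y hy
    simp [logSincGap, sinc_of_ne_zero hy]
  · simp only [id, gapDeriv, Pi.div_apply]
    field_simp
    linear_combination (-c * x ^ 2) * sin_sq_add_cos_sq x

theorem logSincGap_zero (c : ℝ) : logSincGap c 0 = 0 := by simp [logSincGap]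

theorem continuousOn_logSincGap (c : ℝ) : ContinuousOn (logSincGap c) (Set.Icc 0 (π / 2)) := by
  have hne : ∀ x ∈ Set.Icc 0 (π / 2), sinc x ≠ 0 := fun x hx => (sinc_pos_of_mem_Icc hx).ne'
  have hs : ContinuousOn sinc (Set.Icc 0 (π / 2)) := continuous_sinc.continuousOn
  exact (hs.log hne).neg.sub
    (continuousOn_const.mul (continuousOn_const.sub (continuous_cos.continuousOn.div hs hne)))

theorem logSincGap_half_neg : ∀ x ∈ Set.Ioo 0 (π / 2), logSincGap (1 / 2) x < 0 := by
  have hs : ∀ x ∈ Set.Ioo 0 (π / 2), 0 < sin x := fun x hx =>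
    sin_pos_of_pos_of_lt_pi hx.1 (by linarith [hx.2, pi_pos])
  have h2 := neg_of_hasDerivAt_neg (b := π / 2)
    (fun x _ => (hasDerivAt_gapDeriv'' (1 / 2) x).continuousAt.continuousWithinAt)
    (by simp [gapDeriv'']) (fun x _ => hasDerivAt_gapDeriv'' (1 / 2) x)
    (fun x hx => by nlinarith [mul_pos hx.1 (hs x hx)])
  have h1 := neg_of_hasDerivAt_neg (b := π / 2)
    (fun x _ => (hasDerivAt_gapDeriv' (1 / 2) x).continuousAt.continuousWithinAt)
    (by simp [gapDeriv']) (fun x _ => hasDerivAt_gapDeriv' (1 / 2) x)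
    (fun x hx => mul_neg_of_pos_of_neg (by linarith [hs x hx]) (h2 x hx))
  have h0 := neg_of_hasDerivAt_neg (b := π / 2)
    (fun x _ => (hasDerivAt_gapDeriv (1 / 2) x).continuousAt.continuousWithinAt)
    (by simp [gapDeriv]) (fun x _ => hasDerivAt_gapDeriv (1 / 2) x) h1
  exact neg_of_hasDerivAt_neg (continuousOn_logSincGap _) (logSincGap_zero _)
    (fun x hx => hasDerivAt_logSincGap _ hx)
    (fun x hx => div_neg_of_neg_of_pos (h0 x hx) (mul_pos hx.1 (pow_pos (hs x hx) 2)))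

theorem logSincGap_pos {c : ℝ} (hc : c < 1) (hend : 0 ≤ logSincGap c (π / 2)) {x : ℝ}
    (hx : x ∈ Set.Ioo 0 (π / 2)) : 0 < logSincGap c x := by
  have hs : ∀ x, 0 < x → x < π / 2 → 0 < sin x := fun x hx hx' =>
    sin_pos_of_pos_of_lt_pi hx (by linarith [pi_pos])
  have h3 : ∀ x y, 0 < x → x < y → y < π / 2 →
      0 ≤ (1 - 2 * c) * cos y - (1 - c) * (y * sin y) →
      0 < (1 - 2 * c) * cos x - (1 - c) * (x * sin x) := by
    intro x y hx hxy hy h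
    have hsx := hs x hx (hxy.trans hy)
    have hcy : 0 < cos y := cos_pos_of_mem_Ioo ⟨by linarith, hy⟩
    have hcos : cos y < cos x := cos_lt_cos_of_nonneg_of_le_pi_div_two hx.le hy.le hxy
    have hsin : sin x < sin y := sin_lt_sin_of_lt_of_le_pi_div_two (by linarith) hy.le hxy
    have hp : x * sin x < y * sin y := mul_lt_mul'' hxy hsin hx.le hsx.le
    have hp0 : 0 < x * sin x := mul_pos hx hsx
    have hc' : 0 < 1 - c := by linarith
    have hq := mul_lt_mul_of_pos_left hp hc'
    have hq0 := mul_pos hc' hp0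
    have h2c : 0 < 1 - 2 * c := pos_of_mul_pos_left (by linarith : 0 < (1 - 2 * c) * cos y) hcy.le
    have := mul_lt_mul_of_pos_left hcos h2c
    linarith
  have h2 : ∀ x y, 0 < x → x < y → y < π / 2 →
      0 ≤ 4 * sin y * gapDeriv'' c y → 0 < 4 * sin x * gapDeriv'' c x := by
    intro x y hx hxy hy h
    have hsy := hs y (hx.trans hxy) hy
    have hsx := hs x hx (hxy.trans hy)
    refine mul_pos (by linarith) (pos_of_nonneg_of_hasDerivAt
      (fun x _ => (hasDerivAt_gapDeriv'' c x).continuousAt.continuousWithinAt)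
      (by simp [gapDeriv'']) (fun x _ => hasDerivAt_gapDeriv'' c x) h3 hx hxy hy.le ?_)
    exact nonneg_of_mul_nonneg_right h (by linarith)
  have h1 : ∀ x y, 0 < x → x < y → y < π / 2 → 0 ≤ gapDeriv' c y → 0 < gapDeriv' c x :=
    fun x y hx hxy hy h => pos_of_nonneg_of_hasDerivAt
      (fun x _ => (hasDerivAt_gapDeriv' c x).continuousAt.continuousWithinAt)
      (by simp [gapDeriv']) (fun x _ => hasDerivAt_gapDeriv' c x) h2 hx hxy hy.le h
  have h0 : ∀ x y, 0 < x → x < y → y < π / 2 →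
      0 ≤ gapDeriv c y / (y * sin y ^ 2) → 0 < gapDeriv c x / (x * sin x ^ 2) := by
    intro x y hx hxy hy h
    have hy0 := hx.trans hxy
    have hdy : 0 < y * sin y ^ 2 := mul_pos hy0 (pow_pos (hs y hy0 hy) 2)
    have hdx : 0 < x * sin x ^ 2 := mul_pos hx (pow_pos (hs x hx (hxy.trans hy)) 2)
    refine div_pos (pos_of_nonneg_of_hasDerivAt
      (fun x _ => (hasDerivAt_gapDeriv c x).continuousAt.continuousWithinAt)
      (by simp [gapDeriv]) (fun x _ => hasDerivAt_gapDeriv c x) h1 hx hxy hy.le ?_) hdx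
    simpa [hdy.ne'] using mul_nonneg h hdy.le
  exact pos_of_nonneg_of_hasDerivAt (continuousOn_logSincGap c) (logSincGap_zero c)
    (fun x hx => hasDerivAt_logSincGap c hx) h0 hx.1 hx.2 le_rfl hend

theorem log_pi_div_two_lt_one : log (π / 2) < 1 := by
  have := log_le_sub_one_of_pos (by positivity : 0 < π / 2)
  linarith [pi_lt_four]

theorem β₂_eq : β₂ = log (π / 2) / (1 - log (π / 2)) := by
  have h : 2 * exp 1 / π = exp 1 / (π / 2) := by field_simp
  rw [β₂, h, log_div (exp_ne_zero 1) (by positivity), log_exp]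

theorem logSincGap_pi_div_two : logSincGap (log (π / 2)) (π / 2) = 0 := by
  have h : sinc (π / 2) = (π / 2)⁻¹ := by
    rw [sinc_of_ne_zero (by positivity), sin_pi_div_two, one_div]
  simp only [logSincGap, h, log_inv, cos_pi_div_two]
  ring

theorem stmt_10 (x : ℝ) (hx : x ∈ Set.Ioo 0 (π / 2)) :
    (Real.exp (1 - x / Real.tan x) * Real.sin x / x) ^ β₂ < x / Real.sin x ∧
    x / Real.sin x < Real.exp (1 - x / Real.tan x) * Real.sin x / x := by
  have hs : 0 < sin x := sin_pos_of_pos_of_lt_pi hx.1 (by linarith [hx.2, pi_pos])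
  have hx0 := hx.1
  have hlow := logSincGap_pos log_pi_div_two_lt_one logSincGap_pi_div_two.ge hx
  have hup := logSincGap_half_neg x hx
  have hT : cos x / sinc x = x / tan x := by
    rw [sinc_of_ne_zero hx0.ne', tan_eq_sin_div_cos, div_div_eq_mul_div, div_div_eq_mul_div,
      mul_comm]
  have hL : x / sin x = exp (-log (sinc x)) := by
    rw [exp_neg, exp_log (sinc_pos_of_mem_Icc ⟨hx0.le, hx.2.le⟩), sinc_of_ne_zero hx0.ne', inv_div]
  have hS : exp (1 - x / tan x) * sin x / x = exp (1 - x / tan x - -log (sinc x)) := by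
    rw [exp_sub _ (-log (sinc x)), ← hL, div_div_eq_mul_div]
  simp only [logSincGap, hT] at hlow hup
  rw [hS, hL, ← exp_mul, exp_lt_exp, exp_lt_exp, β₂_eq]
  have h1 : 0 < 1 - log (π / 2) := by linarith [log_pi_div_two_lt_one]
  refine ⟨?_, by linarith⟩
  rw [← mul_div_assoc, div_lt_iff₀ h1]
  linarith
end
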